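/- arXiv:0808.0157 — 2 statements merged into one kernel-verified Lean document; each statement's English description precedes it below -/
import Mathlib

section
/- Let Q ∈ ℝ[x,y] be a polynomial whose Newton polygon Θ (the convex hull of its support) is two-dimensional, and suppose Q is real nondegenerate with respect to Θ. Then for every edge Λ of Θ one has Ch_Θ(Q) ∩ Λ̃ = Ch_Λ(Q^Λ), where Q^Λ is the truncation of Q to the monomials with exponents in Λ. -/
noncomputable section

/-- Embedding of an integral point into the real plane. -/
def latticeEmb (p : ℤ × ℤ) : ℝ × ℝ := ((p.1 : ℝ), (p.2 : ℝ))

/-- The real torus (ℝ*)². -/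
def realTorus : Set (ℝ × ℝ) := {q : ℝ × ℝ | q.1 ≠ 0 ∧ q.2 ≠ 0}

/-- The orthogonal reflection ρ_{i,j} with respect to the coordinate axes. -/
def quadRefl (s : Bool × Bool) (q : ℝ × ℝ) : ℝ × ℝ :=
  ((if s.1 then -q.1 else q.1), (if s.2 then -q.2 else q.2))

/-- Ã : the union of the four reflected copies of A. -/
def tildeSet (A : Set (ℝ × ℝ)) : Set (ℝ × ℝ) := ⋃ s : Bool × Bool, quadRefl s '' A

/-- The moment map associated to a (bounded) region `Λ`. -/
def momentMap (Λ : Set (ℝ × ℝ)) (q : ℝ × ℝ) : ℝ × ℝ :=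
  (∑ᶠ (p : ℤ × ℤ) (_ : latticeEmb p ∈ Λ), q.1 ^ p.1 * q.2 ^ p.2)⁻¹ •
    ∑ᶠ (p : ℤ × ℤ) (_ : latticeEmb p ∈ Λ), (q.1 ^ p.1 * q.2 ^ p.2) • latticeEmb p

/-- The symmetric extension φ̃_Λ of the moment map to (ℝ*)². -/
def tildeMomentMap (Λ : Set (ℝ × ℝ)) (q : ℝ × ℝ) : ℝ × ℝ :=
  (Real.sign q.1 * (momentMap Λ (|q.1|, |q.2|)).1,
   Real.sign q.2 * (momentMap Λ (|q.1|, |q.2|)).2)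

/-- Evaluation of a real polynomial in two variables at a point of the plane. -/
def evalQ (q : ℝ × ℝ) (Q : MvPolynomial (Fin 2) ℝ) : ℝ :=
  MvPolynomial.eval ![q.1, q.2] Q

/-- The symbolic restriction (truncation) of `Q` to the monomials with exponents in `Φ`. -/
def trunc (Q : MvPolynomial (Fin 2) ℝ) (Φ : Set (ℝ × ℝ)) : MvPolynomial (Fin 2) ℝ :=
  ∑ᶠ (d : Fin 2 →₀ ℕ) (_ : ((d 0 : ℝ), (d 1 : ℝ)) ∈ Φ),
    MvPolynomial.monomial d (MvPolynomial.coeff d Q)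

/-- The Newton polygon of a polynomial: the convex hull of its support. -/
def newtonPolygon (Q : MvPolynomial (Fin 2) ℝ) : Set (ℝ × ℝ) :=
  convexHull ℝ ((fun d : Fin 2 →₀ ℕ => ((d 0 : ℝ), (d 1 : ℝ))) '' (Q.support : Set (Fin 2 →₀ ℕ)))

/-- `Q` is real nondegenerate with respect to the polygon `Θ`: for every (nonempty) face `Φ`
of `Θ` (including `Θ` itself) the real zero set of the truncation `Q^Φ` in (ℝ*)² is smooth,
i.e. the gradient of `Q^Φ` does not vanish there. -/
def RealNonDeg (Q : MvPolynomial (Fin 2) ℝ) (Θ : Set (ℝ × ℝ)) : Prop :=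
  ∀ Φ : Set (ℝ × ℝ), Φ.Nonempty → IsExposed ℝ Θ Φ → ∀ q ∈ realTorus,
    evalQ q (trunc Q Φ) = 0 →
      evalQ q (MvPolynomial.pderiv 0 (trunc Q Φ)) ≠ 0 ∨
      evalQ q (MvPolynomial.pderiv 1 (trunc Q Φ)) ≠ 0

/-- The Λ-chart of the real curve defined by `Q`: the closure of the image by φ̃_Λ of the real
zero set of `Q` in the torus. -/
def chart (Λ : Set (ℝ × ℝ)) (Q : MvPolynomial (Fin 2) ℝ) : Set (ℝ × ℝ) :=
  closure (tildeMomentMap Λ '' {q ∈ realTorus | evalQ q Q = 0})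


/-- The standard pairing on the plane. -/
def planeDot (p ξ : ℝ × ℝ) : ℝ := p.1 * ξ.1 + p.2 * ξ.2

/-- The exponential sum with exponents in `T` and coefficients `k`. -/
def expSum {E : Type*} [AddCommGroup E] [Module ℝ E] (T : Finset (ℝ × ℝ)) (k : ℝ × ℝ → E)
    (ξ : ℝ × ℝ) : E :=
  ∑ p ∈ T, Real.exp (planeDot p ξ) • k p

/-- The moment map of a finite set of exponents, in logarithmic coordinates. -/
def expMean (T : Finset (ℝ × ℝ)) (ξ : ℝ × ℝ) : ℝ × ℝ :=
  (expSum T (fun _ => (1 : ℝ)) ξ)⁻¹ • expSum T id ξ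

section ExpSum

open Filter Topology

variable {E : Type*} [NormedAddCommGroup E] [NormedSpace ℝ E]

lemma planeDot_add (p ξ η : ℝ × ℝ) : planeDot p (ξ + η) = planeDot p ξ + planeDot p η := by
  simp only [planeDot, Prod.fst_add, Prod.snd_add]; ring

lemma planeDot_smul (p ξ : ℝ × ℝ) (a : ℝ) : planeDot p (a • ξ) = a * planeDot p ξ := by
  simp only [planeDot, Prod.smul_fst, Prod.smul_snd, smul_eq_mul]; ring

lemma planeDot_self_pos {u : ℝ × ℝ} (hu : u ≠ 0) : 0 < planeDot u u := by
  unfold planeDot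
  by_contra! h
  apply hu
  ext
  · simp only [Prod.fst_zero]; nlinarith [mul_self_nonneg u.1, mul_self_nonneg u.2]
  · simp only [Prod.snd_zero]; nlinarith [mul_self_nonneg u.1, mul_self_nonneg u.2]

lemma continuous_planeDot (p : ℝ × ℝ) : Continuous (planeDot p) := by
  unfold planeDot; fun_prop

lemma continuous_expSum (T : Finset (ℝ × ℝ)) (k : ℝ × ℝ → E) : Continuous (expSum T k) := by
  unfold expSum
  exact continuous_finsetSum _ fun p _ =>
    (Real.continuous_exp.comp (continuous_planeDot p)).smul continuous_const

lemma expSum_one_pos {T : Finset (ℝ × ℝ)} (hT : T.Nonempty) (ξ : ℝ × ℝ) :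
    0 < expSum T (fun _ => (1 : ℝ)) ξ :=
  Finset.sum_pos (fun p _ => by simpa using Real.exp_pos _) hT

lemma continuous_expMean {T : Finset (ℝ × ℝ)} (hT : T.Nonempty) : Continuous (expMean T) :=
  ((continuous_expSum T _).inv₀ fun ξ => (expSum_one_pos hT ξ).ne').smul (continuous_expSum T _)

lemma expMean_mem_convex {T : Finset (ℝ × ℝ)} (hT : T.Nonempty) {A : Set (ℝ × ℝ)}
    (hA : Convex ℝ A) (hTA : ∀ p ∈ T, p ∈ A) (ξ : ℝ × ℝ) : expMean T ξ ∈ A := by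
  have h := hA.centerMass_mem (t := T) (w := fun p => Real.exp (planeDot p ξ)) (z := id)
    (fun p _ => (Real.exp_pos _).le) (Finset.sum_pos (fun p _ => Real.exp_pos _) hT) hTA
  simpa [expMean, expSum, Finset.centerMass] using h

/-- Translating by a direction on which all exponents pair to the same value rescales. -/
lemma expSum_add_of_const {F : Finset (ℝ × ℝ)} (k : ℝ × ℝ → E) {η : ℝ × ℝ} {b : ℝ}
    (h : ∀ p ∈ F, planeDot p η = b) (ξ : ℝ × ℝ) :
    expSum F k (ξ + η) = Real.exp b • expSum F k ξ := by
  unfold expSum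
  rw [Finset.smul_sum]
  refine Finset.sum_congr rfl fun p hp => ?_
  rw [planeDot_add, h p hp, Real.exp_add, smul_smul, mul_comm]

lemma expMean_add_of_const {F : Finset (ℝ × ℝ)} {η : ℝ × ℝ} {b : ℝ}
    (h : ∀ p ∈ F, planeDot p η = b) (ξ : ℝ × ℝ) :
    expMean F (ξ + η) = expMean F ξ := by
  have hb := Real.exp_ne_zero b
  unfold expMean
  rw [expSum_add_of_const _ h, expSum_add_of_const _ h, smul_eq_mul, smul_smul, mul_inv,
    mul_right_comm, inv_mul_cancel₀ hb, one_mul]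

/-- Going to infinity in the direction `n`, an exponential sum is asymptotic to its restriction
to the face where `n` is maximal. -/
lemma tendsto_expSum_face {T : Finset (ℝ × ℝ)} {n : ℝ × ℝ} {m : ℝ}
    (hm : ∀ p ∈ T, planeDot p n ≤ m) (k : ℝ × ℝ → E) (ξ : ℝ × ℝ) :
    Tendsto (fun x : (ℝ × ℝ) × ℝ => Real.exp (-(x.2 * m)) • expSum T k (x.1 + x.2 • n))
      (𝓝 ξ ×ˢ atTop) (𝓝 (expSum (T.filter fun p => planeDot p n = m) k ξ)) := by
  unfold expSum
  rw [Finset.sum_filter]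
  simp only [Finset.smul_sum]
  refine tendsto_finsetSum _ fun p hp => ?_
  have key : ∀ x : (ℝ × ℝ) × ℝ,
      Real.exp (-(x.2 * m)) • Real.exp (planeDot p (x.1 + x.2 • n)) • k p =
      (Real.exp (x.2 * (planeDot p n - m)) * Real.exp (planeDot p x.1)) • k p := by
    intro x
    rw [smul_smul, ← Real.exp_add, ← Real.exp_add, planeDot_add, planeDot_smul]
    congr 2; ring
  simp only [key]
  have h1 : Tendsto (fun x : (ℝ × ℝ) × ℝ => Real.exp (planeDot p x.1)) (𝓝 ξ ×ˢ atTop)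
      (𝓝 (Real.exp (planeDot p ξ))) :=
    ((Real.continuous_exp.comp (continuous_planeDot p)).tendsto ξ).comp tendsto_fst
  split_ifs with h
  · simpa [h] using h1.smul_const (k p)
  · have hneg : planeDot p n - m < 0 := sub_neg.2 (lt_of_le_of_ne (hm p hp) h)
    have h2 : Tendsto (fun x : (ℝ × ℝ) × ℝ => Real.exp (x.2 * (planeDot p n - m)))
        (𝓝 ξ ×ˢ atTop) (𝓝 0) :=
      Real.tendsto_exp_atBot.comp ((tendsto_id.atTop_mul_const_of_neg hneg).comp tendsto_snd)
    simpa using (h2.mul h1).smul_const (k p)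

lemma tendsto_expMean_face {T : Finset (ℝ × ℝ)} {n : ℝ × ℝ} {m : ℝ}
    (hm : ∀ p ∈ T, planeDot p n ≤ m) (hF : (T.filter fun p => planeDot p n = m).Nonempty)
    (ξ : ℝ × ℝ) :
    Tendsto (fun x : (ℝ × ℝ) × ℝ => expMean T (x.1 + x.2 • n))
      (𝓝 ξ ×ˢ atTop) (𝓝 (expMean (T.filter fun p => planeDot p n = m) ξ)) := by
  refine (((tendsto_expSum_face hm (fun _ => (1 : ℝ)) ξ).inv₀ (expSum_one_pos hF ξ).ne').smul
    (tendsto_expSum_face hm id ξ)).congr fun x => ?_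
  have hb := Real.exp_ne_zero (-(x.2 * m))
  unfold expMean
  rw [smul_eq_mul, smul_smul, mul_inv, mul_right_comm, inv_mul_cancel₀ hb, one_mul]

lemma hasDerivAt_expSum_line (F : Finset (ℝ × ℝ)) (c : ℝ × ℝ → ℝ) (ξ u : ℝ × ℝ) :
    HasDerivAt (fun a : ℝ => expSum F c (ξ + a • u))
      (expSum F (fun p => planeDot p u * c p) ξ) 0 := by
  unfold expSum
  refine HasDerivAt.fun_sum fun p _ => ?_
  have h1 : HasDerivAt (fun a : ℝ => planeDot p (ξ + a • u)) (planeDot p u) 0 := by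
    simp only [planeDot_add, planeDot_smul]
    simpa using ((hasDerivAt_id (0 : ℝ)).mul_const (planeDot p u)).const_add (planeDot p ξ)
  have h2 := (h1.exp).smul_const (c p)
  simpa [mul_assoc] using h2

/-- A function with a nondegenerate zero takes values of both signs nearby, on both sides. -/
lemma exists_mul_neg_of_hasDerivAt {f : ℝ → ℝ} {f' : ℝ} (hf : HasDerivAt f f' 0) (h0 : f 0 = 0)
    (hf' : f' ≠ 0) {ε : ℝ} (hε : 0 < ε) :
    ∃ δ, 0 < δ ∧ δ < ε ∧ f (-δ) * f δ < 0 := by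
  have h := hasDerivAt_iff_tendsto_slope.1 hf
  have h1 : Tendsto (fun δ : ℝ => slope f 0 δ) (𝓝[>] 0) (𝓝 f') :=
    h.mono_left (nhdsWithin_mono _ fun x hx => ne_of_gt hx)
  have h2 : Tendsto (fun δ : ℝ => slope f 0 (-δ)) (𝓝[>] 0) (𝓝 f') := by
    refine h.comp (tendsto_nhdsWithin_iff.2 ⟨?_, ?_⟩)
    · have : Tendsto (fun δ : ℝ => -δ) (𝓝 0) (𝓝 0) := by simpa using (continuous_neg.tendsto (0:ℝ))
      exact this.mono_left nhdsWithin_le_nhds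
    · filter_upwards [self_mem_nhdsWithin] with x hx
      have : 0 < x := hx
      simp [this.ne']
  have h3 := (h2.mul h1).eventually (lt_mem_nhds (mul_self_pos.2 hf'))
  obtain ⟨δ, hδ, hδ0, hδε⟩ := (h3.and (Ioo_mem_nhdsGT hε)).exists
  refine ⟨δ, hδ0, hδε, ?_⟩
  simp only [slope_def_field, h0, sub_zero] at hδ
  have : f (-δ) / -δ * (f δ / δ) = -(f (-δ) * f δ) / (δ * δ) := by
    field_simp
  rw [this] at hδ
  have := (div_pos_iff_of_pos_right (mul_pos hδ0 hδ0)).1 hδ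
  linarith

/-- A transversal zero of the restriction to a face is a limit of zeros of the whole sum. -/
lemma expMean_face_mem_closure {T : Finset (ℝ × ℝ)} {n : ℝ × ℝ} {m : ℝ}
    (hm : ∀ p ∈ T, planeDot p n ≤ m) (hF : (T.filter fun p => planeDot p n = m).Nonempty)
    (c : ℝ × ℝ → ℝ) {ξ u : ℝ × ℝ}
    (h0 : expSum (T.filter fun p => planeDot p n = m) c ξ = 0)
    (hu : expSum (T.filter fun p => planeDot p n = m) (fun p => planeDot p u * c p) ξ ≠ 0) :
    expMean (T.filter fun p => planeDot p n = m) ξ ∈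
      closure (expMean T '' {ξ | expSum T c ξ = 0}) := by
  rw [mem_closure_iff_nhds]
  intro U hU
  obtain ⟨V, hV, W, hW, hVW⟩ := mem_prod_iff.1 (tendsto_expMean_face hm hF ξ hU)
  have hline : Continuous fun a : ℝ => ξ + a • u := by fun_prop
  have hV' : ∀ᶠ a in 𝓝 (0 : ℝ), ξ + a • u ∈ V := by
    apply hline.continuousAt
    simpa using hV
  obtain ⟨ε, hε, hεV⟩ := Metric.eventually_nhds_iff.1 hV'
  obtain ⟨δ, hδ, hδε, hsign⟩ := exists_mul_neg_of_hasDerivAt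
    (hasDerivAt_expSum_line (T.filter fun p => planeDot p n = m) c ξ u) (by simpa using h0) hu hε
  have hlim : ∀ a : ℝ, Tendsto
      (fun b : ℝ => Real.exp (-(b * m)) • expSum T c (ξ + a • u + b • n)) atTop
      (𝓝 (expSum (T.filter fun p => planeDot p n = m) c (ξ + a • u))) := fun a =>
    (tendsto_expSum_face hm c (ξ + a • u)).comp
      ((tendsto_const_nhds (x := ξ + a • u)).prodMk tendsto_id)
  obtain ⟨b, hb, hbW⟩ :=
    ((((hlim (-δ)).mul (hlim δ)).eventually (gt_mem_nhds hsign)).and hW).exists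
  have hneg : expSum T c (ξ + (-δ) • u + b • n) * expSum T c (ξ + δ • u + b • n) < 0 := by
    have hb' : (Real.exp (-(b * m)) * Real.exp (-(b * m))) *
        (expSum T c (ξ + (-δ) • u + b • n) * expSum T c (ξ + δ • u + b • n)) < 0 := by
      rw [mul_mul_mul_comm]
      exact hb
    exact neg_of_mul_neg_right hb' (by positivity)
  have hcont : ContinuousOn (fun a : ℝ => expSum T c (ξ + a • u + b • n)) (Set.uIcc (-δ) δ) :=
    ((continuous_expSum T c).comp (by fun_prop)).continuousOn
  have hmem : (0 : ℝ) ∈ Set.uIcc (expSum T c (ξ + (-δ) • u + b • n))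
      (expSum T c (ξ + δ • u + b • n)) := by
    rw [Set.mem_uIcc]
    rcases mul_neg_iff.1 hneg with h | h
    · exact Or.inr ⟨h.2.le, h.1.le⟩
    · exact Or.inl ⟨h.1.le, h.2.le⟩
  obtain ⟨a, ha, haz⟩ := intermediate_value_uIcc hcont hmem
  rw [Set.uIcc_of_le (by linarith)] at ha
  refine ⟨expMean T (ξ + a • u + b • n), ?_, ξ + a • u + b • n, haz, rfl⟩
  refine hVW (a := (ξ + a • u, b)) ⟨hεV ?_, hbW⟩
  rw [Real.dist_eq, sub_zero]
  exact (abs_le.2 ha).trans_lt hδε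

/-- On a segment, an exponential sum with nonzero coefficient at the end point `w` is bounded
below in terms of the sum of all exponentials, far in the direction `w - v`. -/
lemma exists_lower_bound_segment {F : Finset (ℝ × ℝ)} {v w : ℝ × ℝ} (hvw : v ≠ w)
    (hw : w ∈ F) (hF : ∀ p ∈ F, p ∈ segment ℝ v w) {c : ℝ × ℝ → ℝ} (hc : c w ≠ 0) :
    ∀ᶠ a : ℝ in atTop, |c w| / 2 <
      |expSum F c (a • (w - v)) / expSum F (fun _ => (1 : ℝ)) (a • (w - v))| := by
  have hpos := planeDot_self_pos (sub_ne_zero.2 hvw.symm)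
  have hdot : ∀ p ∈ F, ∃ t : ℝ, 0 ≤ t ∧ p = w - t • (w - v) ∧
      planeDot p (w - v) = planeDot w (w - v) - t * planeDot (w - v) (w - v) := by
    intro p hp
    obtain ⟨t, s, ht, hs, hts, rfl⟩ := hF p hp
    obtain rfl : s = 1 - t := by linarith
    refine ⟨t, ht, ?_, ?_⟩
    · module
    · simp [planeDot]; ring
  have hle : ∀ p ∈ F, planeDot p (w - v) ≤ planeDot w (w - v) := by
    intro p hp
    obtain ⟨t, ht, -, h⟩ := hdot p hp
    rw [h]
    linarith [mul_nonneg ht hpos.le]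
  have hface : (F.filter fun p => planeDot p (w - v) = planeDot w (w - v)) = {w} := by
    ext p
    simp only [Finset.mem_filter, Finset.mem_singleton]
    constructor
    · rintro ⟨hp, h⟩
      obtain ⟨t, ht, h1, h2⟩ := hdot p hp
      have : t = 0 := by
        have : t * planeDot (w - v) (w - v) = 0 := by linarith
        exact (mul_eq_zero.1 this).resolve_right hpos.ne'
      simpa [this] using h1
    · rintro rfl
      exact ⟨hw, rfl⟩
  have hlim : ∀ k : ℝ × ℝ → ℝ, Tendsto (fun b : ℝ =>
      Real.exp (-(b * planeDot w (w - v))) • expSum F k (b • (w - v))) atTop (𝓝 (k w)) := by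
    intro k
    have := (tendsto_expSum_face hle k 0).comp
      ((tendsto_const_nhds (x := (0 : ℝ × ℝ))).prodMk tendsto_id)
    rw [hface] at this
    simpa [expSum, planeDot, Function.comp_def] using this
  have h := ((hlim c).div (hlim fun _ => 1) one_ne_zero).abs
  rw [div_one] at h
  filter_upwards [h.eventually (lt_mem_nhds (half_lt_self (abs_pos.2 hc)))] with a ha
  simpa only [Pi.div_apply, smul_eq_mul, mul_div_mul_left _ _ (Real.exp_ne_zero _)] using ha

lemma planeDot_expMean {T : Finset (ℝ × ℝ)} (ξ n : ℝ × ℝ) :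
    planeDot (expMean T ξ) n = (expSum T (fun _ => (1 : ℝ)) ξ)⁻¹ *
      expSum T (fun p => planeDot p n) ξ := by
  simp only [expMean, expSum, planeDot, Prod.smul_fst, Prod.smul_snd, Prod.fst_sum, Prod.snd_sum,
    smul_eq_mul, id, mul_assoc, Finset.sum_mul, mul_add, Finset.sum_add_distrib]

/-- If the moment map tends to the face where `n` is maximal, then the weights of the exponents
outside of this face tend to zero. -/
lemma tendsto_weight_zero {α : Type*} {l : Filter α} {T : Finset (ℝ × ℝ)} {n : ℝ × ℝ} {m : ℝ}
    (hm : ∀ p ∈ T, planeDot p n ≤ m) {ξ : α → ℝ × ℝ} {z : ℝ × ℝ} (hz : planeDot z n = m)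
    (hlim : Tendsto (fun x => expMean T (ξ x)) l (𝓝 z)) {p : ℝ × ℝ} (hp : p ∈ T)
    (hpm : planeDot p n ≠ m) :
    Tendsto (fun x => (expSum T (fun _ => (1 : ℝ)) (ξ x))⁻¹ * Real.exp (planeDot p (ξ x)))
      l (𝓝 0) := by
  have hpm' : 0 < m - planeDot p n := sub_pos.2 (lt_of_le_of_ne (hm p hp) hpm)
  have hdot : Continuous fun q : ℝ × ℝ => m - planeDot q n := by unfold planeDot; fun_prop
  have h1 : Tendsto (fun x => (m - planeDot (expMean T (ξ x)) n) / (m - planeDot p n)) l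
      (𝓝 0) := by
    have := ((hdot.tendsto z).comp hlim).div_const (m - planeDot p n)
    simpa [hz] using this
  refine squeeze_zero (fun x => ?_) (fun x => ?_) h1
  · exact mul_nonneg (inv_nonneg.2 (expSum_one_pos ⟨p, hp⟩ _).le) (Real.exp_pos _).le
  · have hS := expSum_one_pos ⟨p, hp⟩ (ξ x)
    rw [le_div_iff₀ hpm', planeDot_expMean]
    have h2 : Real.exp (planeDot p (ξ x)) * (m - planeDot p n) ≤
        expSum T (fun q => m - planeDot q n) (ξ x) := by
      unfold expSum
      exact Finset.single_le_sum (f := fun q => Real.exp (planeDot q (ξ x)) • (m - planeDot q n))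
        (fun q hq => mul_nonneg (Real.exp_pos _).le (sub_nonneg.2 (hm q hq))) hp
    have h3 : expSum T (fun q => m - planeDot q n) (ξ x) =
        m * expSum T (fun _ => (1 : ℝ)) (ξ x) - expSum T (fun q => planeDot q n) (ξ x) := by
      simp only [expSum, smul_eq_mul, mul_sub, Finset.sum_sub_distrib, Finset.mul_sum, mul_one]
      congr 1
      exact Finset.sum_congr rfl fun _ _ => mul_comm _ _
    rw [h3] at h2
    rw [mul_assoc, inv_mul_le_iff₀ hS, mul_sub (expSum _ _ _), mul_inv_cancel_left₀ hS.ne']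
    linarith

/-- If the moment map tends to a face, then exponential sums normalised by the total weight differ
from their restriction to this face by a null function. -/
lemma tendsto_expSum_sub_face {α : Type*} {l : Filter α} {T : Finset (ℝ × ℝ)} {n : ℝ × ℝ} {m : ℝ}
    (hm : ∀ p ∈ T, planeDot p n ≤ m) {ξ : α → ℝ × ℝ} {z : ℝ × ℝ} (hz : planeDot z n = m)
    (hlim : Tendsto (fun x => expMean T (ξ x)) l (𝓝 z)) (k : ℝ × ℝ → E) :
    Tendsto (fun x => (expSum T (fun _ => (1 : ℝ)) (ξ x))⁻¹ •
      (expSum T k (ξ x) - expSum (T.filter fun p => planeDot p n = m) k (ξ x))) l (𝓝 0) := by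
  have : ∀ x, (expSum T (fun _ => (1 : ℝ)) (ξ x))⁻¹ •
      (expSum T k (ξ x) - expSum (T.filter fun p => planeDot p n = m) k (ξ x)) =
      ∑ p ∈ T.filter (fun p => ¬ planeDot p n = m),
        ((expSum T (fun _ => (1 : ℝ)) (ξ x))⁻¹ * Real.exp (planeDot p (ξ x))) • k p := by
    intro x
    simp only [mul_smul, ← Finset.smul_sum]
    congr 1
    rw [sub_eq_iff_eq_add']
    exact (Finset.sum_filter_add_sum_filter_not T _ _).symm
  simp only [this]
  rw [show (0 : E) = ∑ p ∈ T.filter (fun p => ¬ planeDot p n = m), (0 : ℝ) • k p by simp]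
  refine tendsto_finsetSum _ fun p hp => ?_
  rw [Finset.mem_filter] at hp
  exact (tendsto_weight_zero hm hz hlim hp.1 hp.2).smul_const (k p)

/-- A limit of the moment map on zeros which lies on an edge is attained at a zero of the
restriction to this edge. -/
lemma exists_zero_of_mem_closure {T : Finset (ℝ × ℝ)} {n : ℝ × ℝ} {m : ℝ}
    (hm : ∀ p ∈ T, planeDot p n ≤ m) {c : ℝ × ℝ → ℝ} {v w z : ℝ × ℝ} (hvw : v ≠ w)
    (hv : v ∈ T.filter fun p => planeDot p n = m) (hw : w ∈ T.filter fun p => planeDot p n = m)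
    (hF : ∀ p ∈ T.filter (fun p => planeDot p n = m), p ∈ segment ℝ v w)
    (hcv : c v ≠ 0) (hcw : c w ≠ 0) (hz : planeDot z n = m)
    (hcl : z ∈ closure (expMean T '' {ξ | expSum T c ξ = 0})) :
    z ∈ expMean (T.filter fun p => planeDot p n = m) ''
      {ξ | expSum (T.filter fun p => planeDot p n = m) c ξ = 0} := by
  set F := T.filter fun p => planeDot p n = m with hFdef
  have hFne : F.Nonempty := ⟨v, hv⟩
  have hTne : T.Nonempty := ⟨v, (Finset.mem_filter.1 hv).1⟩
  obtain ⟨y, hy, hyz⟩ := mem_closure_iff_seq_limit.1 hcl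
  choose ξ hξ hξy using hy
  have hlim : Tendsto (fun i => expMean T (ξ i)) atTop (𝓝 z) := by simpa only [hξy] using hyz
  have hne : ∀ i, expSum T (fun _ => (1 : ℝ)) (ξ i) ≠ 0 := fun i => (expSum_one_pos hTne _).ne'
  have hneF : ∀ η, expSum F (fun _ => (1 : ℝ)) η ≠ 0 := fun i => (expSum_one_pos hFne _).ne'
  have hone : Tendsto (fun i => (expSum T (fun _ => (1 : ℝ)) (ξ i))⁻¹ *
      expSum F (fun _ => (1 : ℝ)) (ξ i)) atTop (𝓝 1) := by
    have h := (tendsto_expSum_sub_face hm hz hlim fun _ => (1 : ℝ)).const_sub 1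
    rw [sub_zero] at h
    refine h.congr fun i => ?_
    rw [smul_eq_mul, mul_sub, inv_mul_cancel₀ (hne i), sub_sub_cancel]
  have hzero : Tendsto (fun i => expSum F c (ξ i) / expSum F (fun _ => (1 : ℝ)) (ξ i)) atTop
      (𝓝 0) := by
    have h := (tendsto_expSum_sub_face hm hz hlim c).neg.div hone one_ne_zero
    rw [neg_zero, zero_div] at h
    refine h.congr fun i => ?_
    have h0 : expSum T c (ξ i) = 0 := hξ i
    simp only [Pi.div_apply]
    rw [h0, zero_sub, smul_neg, neg_neg, smul_eq_mul,
      mul_div_mul_left _ _ (inv_ne_zero (hne i))]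
  have hmean : Tendsto (fun i => expMean F (ξ i)) atTop (𝓝 z) := by
    have h := (hone.inv₀ one_ne_zero).smul
      (hlim.sub (tendsto_expSum_sub_face hm hz hlim id))
    rw [inv_one, one_smul, sub_zero] at h
    refine h.congr fun i => ?_
    simp only [expMean]
    rw [← smul_sub, sub_sub_cancel, smul_smul, mul_inv, inv_inv, mul_right_comm,
      mul_inv_cancel₀ (hne i), one_mul]
  set u := w - v with hu
  have hupos : u.1 * u.1 + u.2 * u.2 ≠ 0 := (planeDot_self_pos (sub_ne_zero.2 hvw.symm)).ne'
  let a : ℕ → ℝ := fun i => planeDot u (ξ i) / (u.1 * u.1 + u.2 * u.2)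
  have hred : ∀ i, ∀ p ∈ F, planeDot p (ξ i - a i • u) = planeDot v (ξ i - a i • u) := by
    intro i p hp
    have hu0 : planeDot u (ξ i - a i • u) = 0 := by
      have : a i * (u.1 * u.1 + u.2 * u.2) = planeDot u (ξ i) := div_mul_cancel₀ _ hupos
      simp only [planeDot, Prod.fst_sub, Prod.snd_sub, Prod.smul_fst, Prod.smul_snd,
        smul_eq_mul] at this ⊢
      linear_combination -this
    have : p ∈ (fun θ : ℝ => v + θ • (w - v)) '' Set.Icc 0 1 := by
      rw [← segment_eq_image']; exact hF p hp
    obtain ⟨θ, -, rfl⟩ := this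
    have h2 : planeDot (v + θ • u) (ξ i - a i • u) =
        planeDot v (ξ i - a i • u) + θ * planeDot u (ξ i - a i • u) := by
      simp only [planeDot, Prod.fst_add, Prod.snd_add, Prod.smul_fst, Prod.smul_snd, smul_eq_mul]
      ring
    exact h2.trans (by rw [hu0, mul_zero, add_zero])
  have hdec : ∀ i, ξ i = a i • u + (ξ i - a i • u) := fun i => by abel
  have hratio : ∀ i, expSum F c (ξ i) / expSum F (fun _ => (1 : ℝ)) (ξ i) =
      expSum F c (a i • u) / expSum F (fun _ => (1 : ℝ)) (a i • u) := by
    intro i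
    conv_lhs => rw [hdec i]
    rw [expSum_add_of_const _ (hred i), expSum_add_of_const _ (hred i), smul_eq_mul, smul_eq_mul,
      mul_div_mul_left _ _ (Real.exp_ne_zero _)]
  have hmean' : ∀ i, expMean F (ξ i) = expMean F (a i • u) := by
    intro i
    conv_lhs => rw [hdec i, expMean_add_of_const (hred i)]
  simp only [hratio] at hzero
  simp only [hmean'] at hmean
  obtain ⟨A, hA⟩ := eventually_atTop.1 (exists_lower_bound_segment hvw hw hF hcw)
  obtain ⟨B, hB⟩ := eventually_atTop.1 (exists_lower_bound_segment hvw.symm hv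
    (fun p hp => segment_symm ℝ v w ▸ hF p hp) hcv)
  have hbdd : ∀ᶠ i in atTop, a i ∈ Set.Icc (-B) A := by
    have h := hzero.abs
    rw [abs_zero] at h
    filter_upwards [h.eventually (gt_mem_nhds (half_pos (abs_pos.2 hcw))),
      h.eventually (gt_mem_nhds (half_pos (abs_pos.2 hcv)))] with i h1 h2
    constructor
    · by_contra! hlt
      have h3 := hB (-a i) (by linarith)
      rw [show -a i • (v - w) = a i • u by rw [hu]; module] at h3
      linarith
    · by_contra! hlt
      have h3 := hA (a i) hlt.le
      linarith
  obtain ⟨a₀, -, φ, hφ, hφa⟩ :=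
    (isCompact_Icc (a := -B) (b := A)).tendsto_subseq' hbdd.frequently
  have hline : Continuous fun t : ℝ => t • u := by fun_prop
  refine ⟨a₀ • u, ?_, ?_⟩
  · have hcont : Continuous fun t : ℝ =>
        expSum F c (t • u) / expSum F (fun _ => (1 : ℝ)) (t • u) :=
      ((continuous_expSum F c).comp hline).div ((continuous_expSum F _).comp hline)
        fun t => hneF _
    have := tendsto_nhds_unique ((hcont.tendsto a₀).comp hφa) (hzero.comp hφ.tendsto_atTop)
    exact (div_eq_zero_iff.1 this).resolve_right (hneF _)
  · exact tendsto_nhds_unique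
      ((((continuous_expMean hFne).comp hline).tendsto a₀).comp hφa)
      (hmean.comp hφ.tendsto_atTop)

end ExpSum

/-- The exponent of a monomial as a point of the plane. -/
def exponentPoint (d : Fin 2 →₀ ℕ) : ℝ × ℝ := ((d 0 : ℝ), (d 1 : ℝ))

/-- The monomial exponent given by the integral parts of the coordinates. -/
def floorExponent (p : ℝ × ℝ) : Fin 2 →₀ ℕ :=
  Finsupp.equivFunOnFinite.symm ![⌊p.1⌋₊, ⌊p.2⌋₊]

/-- The point of the torus with logarithmic coordinates `ξ` in the quadrant `s`. -/
def quadExp (s : Bool × Bool) (ξ : ℝ × ℝ) : ℝ × ℝ :=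
  quadRefl s (Real.exp ξ.1, Real.exp ξ.2)

/-- The coefficient at the exponent `p` of `P` restricted to the quadrant `s`. -/
def signCoeff (P : MvPolynomial (Fin 2) ℝ) (s : Bool × Bool) (p : ℝ × ℝ) : ℝ :=
  P.coeff (floorExponent p) *
    ((if s.1 then -1 else 1) ^ floorExponent p 0 * (if s.2 then -1 else 1) ^ floorExponent p 1)

section Charts

open Filter Topology

lemma floorExponent_exponentPoint (d : Fin 2 →₀ ℕ) : floorExponent (exponentPoint d) = d := by
  ext i
  fin_cases i <;> simp [floorExponent, exponentPoint]

lemma exponentPoint_injective : Function.Injective exponentPoint :=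
  Function.LeftInverse.injective floorExponent_exponentPoint

lemma exists_exponentPoint {p : ℝ × ℝ} (h : p ∈ Set.range latticeEmb) (h0 : 0 ≤ p.1 ∧ 0 ≤ p.2) :
    ∃ d, exponentPoint d = p := by
  obtain ⟨⟨a, b⟩, rfl⟩ := h
  simp only [latticeEmb, Int.cast_nonneg_iff] at h0
  lift a to ℕ using h0.1
  lift b to ℕ using h0.2
  exact ⟨Finsupp.equivFunOnFinite.symm ![a, b], by simp [exponentPoint, latticeEmb]⟩

lemma exponentPoint_mem_range (d : Fin 2 →₀ ℕ) : exponentPoint d ∈ Set.range latticeEmb :=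
  ⟨(d 0, d 1), by simp [exponentPoint, latticeEmb]⟩

lemma continuous_quadRefl (s : Bool × Bool) : Continuous (quadRefl s) := by
  unfold quadRefl
  split_ifs <;> fun_prop

lemma quadRefl_quadRefl (s : Bool × Bool) (q : ℝ × ℝ) : quadRefl s (quadRefl s q) = q := by
  unfold quadRefl
  ext <;> dsimp only <;> split_ifs <;> simp

lemma closure_quadRefl_image (s : Bool × Bool) (A : Set (ℝ × ℝ)) :
    closure (quadRefl s '' A) = quadRefl s '' closure A :=
  ((Homeomorph.mk ⟨quadRefl s, quadRefl s, quadRefl_quadRefl s, quadRefl_quadRefl s⟩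
    (continuous_quadRefl s) (continuous_quadRefl s)).image_closure A).symm

/-- In the closed positive quadrant, reflected copies of `A` meet only along `A`. -/
lemma mem_of_quadRefl_mem_tildeSet {A : Set (ℝ × ℝ)} (hA : ∀ p ∈ A, 0 ≤ p.1 ∧ 0 ≤ p.2)
    {s : Bool × Bool} {z : ℝ × ℝ} (hz : 0 ≤ z.1 ∧ 0 ≤ z.2) (h : quadRefl s z ∈ tildeSet A) :
    z ∈ A := by
  obtain ⟨t, p, hp, hpz⟩ := Set.mem_iUnion.1 h
  obtain ⟨hp1, hp2⟩ := hA p hp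
  have habs : ∀ (r : Bool × Bool) (x : ℝ × ℝ), 0 ≤ x.1 → 0 ≤ x.2 →
      (|(quadRefl r x).1|, |(quadRefl r x).2|) = x := by
    intro r x h1 h2
    unfold quadRefl
    ext <;> dsimp only <;> split_ifs <;> simp [abs_of_nonneg, h1, h2]
  rw [← habs s z hz.1 hz.2, ← hpz, habs t p hp1 hp2]
  exact hp

lemma quadExp_mem_realTorus (s : Bool × Bool) (ξ : ℝ × ℝ) : quadExp s ξ ∈ realTorus := by
  simp only [quadExp, quadRefl, realTorus, Set.mem_ofPred_eq]
  constructor <;> split_ifs <;> simp [Real.exp_ne_zero]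

lemma exists_quadExp {q : ℝ × ℝ} (hq : q ∈ realTorus) : ∃ s ξ, quadExp s ξ = q := by
  refine ⟨(decide (q.1 < 0), decide (q.2 < 0)), (Real.log q.1, Real.log q.2), ?_⟩
  simp only [quadExp, quadRefl, Real.exp_log_eq_abs hq.1, Real.exp_log_eq_abs hq.2,
    decide_eq_true_eq]
  ext <;> dsimp only <;> split_ifs with h
  · rw [abs_of_neg h, neg_neg]
  · rw [abs_of_nonneg (not_lt.1 h)]
  · rw [abs_of_neg h, neg_neg]
  · rw [abs_of_nonneg (not_lt.1 h)]

lemma signCoeff_exponentPoint (P : MvPolynomial (Fin 2) ℝ) (s : Bool × Bool) (d : Fin 2 →₀ ℕ) :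
    signCoeff P s (exponentPoint d) =
      P.coeff d * ((if s.1 then -1 else 1) ^ d 0 * (if s.2 then -1 else 1) ^ d 1) := by
  rw [signCoeff, floorExponent_exponentPoint]

lemma signCoeff_exponentPoint_ne_zero {P : MvPolynomial (Fin 2) ℝ} {d : Fin 2 →₀ ℕ}
    (h : d ∈ P.support) (s : Bool × Bool) : signCoeff P s (exponentPoint d) ≠ 0 := by
  rw [signCoeff_exponentPoint]
  refine mul_ne_zero (MvPolynomial.mem_support_iff.1 h)
    (mul_ne_zero (pow_ne_zero _ ?_) (pow_ne_zero _ ?_)) <;> split_ifs <;> norm_num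

/-- In logarithmic coordinates a polynomial becomes an exponential sum on each quadrant. -/
lemma evalQ_quadExp {P : MvPolynomial (Fin 2) ℝ} {T : Finset (ℝ × ℝ)}
    (hT : ∀ p ∈ T, ∃ d, exponentPoint d = p) (hP : ∀ d ∈ P.support, exponentPoint d ∈ T)
    (s : Bool × Bool) (ξ : ℝ × ℝ) :
    evalQ (quadExp s ξ) P = expSum T (signCoeff P s) ξ := by
  have himage : P.support.image exponentPoint ⊆ T := Finset.image_subset_iff.2 hP
  rw [evalQ, MvPolynomial.eval_eq', expSum, ← Finset.sum_subset himage,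
    Finset.sum_image exponentPoint_injective.injOn]
  · refine Finset.sum_congr rfl fun d _ => ?_
    rw [signCoeff_exponentPoint]
    have hexp : Real.exp (planeDot (exponentPoint d) ξ) =
        Real.exp ξ.1 ^ d 0 * Real.exp ξ.2 ^ d 1 := by
      rw [planeDot, Real.exp_add, exponentPoint, Real.exp_nat_mul, Real.exp_nat_mul]
    have hsign : ∀ (b : Bool) (x : ℝ) (k : ℕ), (if b then -x else x) ^ k =
        (if b then -1 else 1) ^ k * x ^ k := by
      intro b x k
      rw [← mul_pow]
      cases b <;> simp
    simp only [Fin.prod_univ_two, quadExp, quadRefl, Matrix.cons_val_zero, Matrix.cons_val_one,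
      hexp, hsign _ (Real.exp _), smul_eq_mul]
    ring
  · intro p hp hp'
    obtain ⟨d, rfl⟩ := hT p hp
    have hd : d ∉ P.support := fun h => hp' (Finset.mem_image_of_mem _ h)
    rw [signCoeff_exponentPoint, MvPolynomial.notMem_support_iff.1 hd, zero_mul, smul_zero]

lemma finsum_latticeEmb {E : Type*} [AddCommMonoid E] {A : Set (ℝ × ℝ)} {T : Finset (ℝ × ℝ)}
    (hT : ∀ p, p ∈ T ↔ p ∈ A ∧ p ∈ Set.range latticeEmb) (g : ℝ × ℝ → E) :
    ∑ᶠ (p : ℤ × ℤ) (_ : latticeEmb p ∈ A), g (latticeEmb p) = ∑ p ∈ T, g p := by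
  have hinj : Function.Injective latticeEmb := by
    rintro ⟨a, b⟩ ⟨c, d⟩ h
    simpa [latticeEmb] using h
  have himage : (T : Set (ℝ × ℝ)) = latticeEmb '' (latticeEmb ⁻¹' A) := by
    ext p
    simp [hT, Set.image_preimage_eq_inter_range]
  rw [← finsum_mem_coe_finset, himage, finsum_mem_image hinj.injOn]
  rfl

lemma tildeMomentMap_quadExp {A : Set (ℝ × ℝ)} {T : Finset (ℝ × ℝ)}
    (hT : ∀ p, p ∈ T ↔ p ∈ A ∧ p ∈ Set.range latticeEmb) (s : Bool × Bool) (ξ : ℝ × ℝ) :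
    tildeMomentMap A (quadExp s ξ) = quadRefl s (expMean T ξ) := by
  have hexp : ∀ p : ℤ × ℤ, Real.exp ξ.1 ^ p.1 * Real.exp ξ.2 ^ p.2 =
      Real.exp (planeDot (latticeEmb p) ξ) := by
    intro p
    rw [planeDot, Real.exp_add, latticeEmb, mul_comm (p.1 : ℝ), mul_comm (p.2 : ℝ), Real.exp_mul,
      Real.exp_mul, Real.rpow_intCast, Real.rpow_intCast]
  have hmom : momentMap A (Real.exp ξ.1, Real.exp ξ.2) = expMean T ξ := by
    simp only [momentMap, hexp]
    rw [finsum_latticeEmb hT fun p => Real.exp (planeDot p ξ),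
      finsum_latticeEmb hT fun p => Real.exp (planeDot p ξ) • p]
    simp [expMean, expSum]
  have habs : (|(quadExp s ξ).1|, |(quadExp s ξ).2|) = (Real.exp ξ.1, Real.exp ξ.2) := by
    unfold quadExp quadRefl
    ext <;> dsimp only <;> split_ifs <;> simp
  rw [tildeMomentMap, habs, hmom]
  unfold quadExp quadRefl
  ext <;> dsimp only <;> split_ifs <;>
    simp [Real.sign_of_pos (Real.exp_pos _), Real.sign_neg]

/-- The chart is the union of its pieces in the four quadrants. -/
lemma chart_eq_iUnion {A : Set (ℝ × ℝ)} {T : Finset (ℝ × ℝ)} {P : MvPolynomial (Fin 2) ℝ}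
    (hA : ∀ p ∈ A, 0 ≤ p.1 ∧ 0 ≤ p.2)
    (hT : ∀ p, p ∈ T ↔ p ∈ A ∧ p ∈ Set.range latticeEmb)
    (hP : ∀ d ∈ P.support, exponentPoint d ∈ A) :
    chart A P =
      ⋃ s, quadRefl s '' closure (expMean T '' {ξ | expSum T (signCoeff P s) ξ = 0}) := by
  have heval := evalQ_quadExp (P := P) (T := T)
    (fun p hp => exists_exponentPoint ((hT p).1 hp).2 (hA p ((hT p).1 hp).1))
    (fun d hd => (hT _).2 ⟨hP d hd, exponentPoint_mem_range d⟩)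
  simp only [← closure_quadRefl_image]
  rw [chart, ← closure_iUnion_of_finite]
  congr 1
  ext z
  simp only [Set.mem_iUnion, Set.mem_image, Set.mem_ofPred_eq]
  constructor
  · rintro ⟨q, ⟨hq, hq0⟩, rfl⟩
    obtain ⟨s, ξ, rfl⟩ := exists_quadExp hq
    exact ⟨s, _, ⟨ξ, by rw [← heval, hq0], rfl⟩, (tildeMomentMap_quadExp hT s ξ).symm⟩
  · rintro ⟨s, _, ⟨ξ, hξ, rfl⟩, rfl⟩
    exact ⟨quadExp s ξ, ⟨quadExp_mem_realTorus s ξ, by rw [heval, hξ]⟩,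
      tildeMomentMap_quadExp hT s ξ⟩

lemma exists_latticeFinset {A : Set (ℝ × ℝ)} (hA : Bornology.IsBounded A) :
    ∃ T : Finset (ℝ × ℝ), ∀ p, p ∈ T ↔ p ∈ A ∧ p ∈ Set.range latticeEmb := by
  obtain ⟨R, hR⟩ := hA.exists_norm_le
  have hfin : (A ∩ Set.range latticeEmb).Finite := by
    refine ((Set.finite_Icc ((-⌈R⌉, -⌈R⌉) : ℤ × ℤ) (⌈R⌉, ⌈R⌉)).image latticeEmb).subset ?_
    rintro _ ⟨hpA, ⟨a, b⟩, rfl⟩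
    refine ⟨(a, b), ?_, rfl⟩
    have h := (hR _ hpA).trans (Int.le_ceil R)
    simp only [latticeEmb, Prod.norm_def, sup_le_iff, Real.norm_eq_abs, abs_le] at h
    exact_mod_cast And.intro (And.intro h.1.1 h.2.1) (And.intro h.1.2 h.2.2)
  exact ⟨hfin.toFinset, fun p => by simp⟩

lemma coeff_trunc {Q : MvPolynomial (Fin 2) ℝ} {A : Set (ℝ × ℝ)} (d : Fin 2 →₀ ℕ)
    (hd : exponentPoint d ∈ A) : (trunc Q A).coeff d = Q.coeff d := by
  classical
  have h : trunc Q A = ∑ e ∈ Q.support.filter (fun e => exponentPoint e ∈ A),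
      MvPolynomial.monomial e (Q.coeff e) := by
    refine finsum_mem_eq_sum_of_inter_support_eq _ (s := {e | exponentPoint e ∈ A}) ?_
    ext e
    simp [and_comm]
  rw [h, MvPolynomial.coeff_sum]
  simp only [MvPolynomial.coeff_monomial, Finset.sum_ite_eq', Finset.mem_filter]
  split_ifs with h'
  · rfl
  · exact (MvPolynomial.notMem_support_iff.1 fun hs => h' ⟨hs, hd⟩).symm

lemma exponentPoint_mem_of_mem_support_trunc {Q : MvPolynomial (Fin 2) ℝ} {A : Set (ℝ × ℝ)}
    {d : Fin 2 →₀ ℕ} (hd : d ∈ (trunc Q A).support) : exponentPoint d ∈ A := by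
  classical
  by_contra h
  refine MvPolynomial.mem_support_iff.1 hd ?_
  have hmem : trunc Q A ∈ LinearMap.ker (MvPolynomial.lcoeff ℝ d) := by
    unfold trunc
    refine finsum_mem_induction (· ∈ LinearMap.ker (MvPolynomial.lcoeff ℝ d)) (Submodule.zero_mem _)
      (fun _ _ => Submodule.add_mem _) (s := {e | exponentPoint e ∈ A}) ?_
    intro e he
    have : e ≠ d := fun hed => h (hed ▸ he)
    simp [MvPolynomial.coeff_monomial, this]
  simpa using hmem

lemma coeff_X_mul_pderiv (P : MvPolynomial (Fin 2) ℝ) (i : Fin 2) (d : Fin 2 →₀ ℕ) :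
    (MvPolynomial.X i * MvPolynomial.pderiv i P).coeff d = d i * P.coeff d := by
  classical
  induction P using MvPolynomial.induction_on' with
  | monomial e r =>
    rw [MvPolynomial.X_mul_pderiv_monomial]
    rw [MvPolynomial.coeff_smul, MvPolynomial.coeff_monomial, nsmul_eq_mul]
    split_ifs with h
    · rw [h]
    · simp
  | add p q hp hq => rw [map_add, mul_add, MvPolynomial.coeff_add, hp, hq, MvPolynomial.coeff_add,
      mul_add]

/-- The logarithmic derivatives of a polynomial in logarithmic coordinates. -/
lemma mul_evalQ_pderiv {P : MvPolynomial (Fin 2) ℝ} {T : Finset (ℝ × ℝ)}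
    (hT : ∀ p ∈ T, ∃ d, exponentPoint d = p) (hP : ∀ d ∈ P.support, exponentPoint d ∈ T)
    (s : Bool × Bool) (ξ : ℝ × ℝ) (i : Fin 2) :
    ![(quadExp s ξ).1, (quadExp s ξ).2] i * evalQ (quadExp s ξ) (MvPolynomial.pderiv i P) =
      expSum T (fun p => ![p.1, p.2] i * signCoeff P s p) ξ := by
  have h := evalQ_quadExp (P := MvPolynomial.X i * MvPolynomial.pderiv i P) hT
    (fun d hd => hP d ?_) s ξ
  · simp only [evalQ, map_mul, MvPolynomial.eval_X] at h ⊢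
    rw [h]
    refine Finset.sum_congr rfl fun p hp => ?_
    obtain ⟨d, rfl⟩ := hT p hp
    simp only [signCoeff_exponentPoint, coeff_X_mul_pderiv]
    fin_cases i <;> simp [exponentPoint, mul_assoc]
  · rw [MvPolynomial.mem_support_iff, coeff_X_mul_pderiv] at hd
    exact MvPolynomial.mem_support_iff.2 (right_ne_zero_of_mul hd)

/-- A nondegenerate zero of a polynomial supported on a line is transversal to the level sets of
the corresponding character. -/
lemma expSum_planeDot_ne_zero {P : MvPolynomial (Fin 2) ℝ} {T : Finset (ℝ × ℝ)}
    (hT : ∀ p ∈ T, ∃ d, exponentPoint d = p) (hP : ∀ d ∈ P.support, exponentPoint d ∈ T)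
    {s : Bool × Bool} {ξ u : ℝ × ℝ} (hu : u ≠ 0) {b : ℝ}
    (hline : ∀ p ∈ T, planeDot p (-u.2, u.1) = b)
    (h0 : expSum T (signCoeff P s) ξ = 0)
    (hnd : evalQ (quadExp s ξ) (MvPolynomial.pderiv 0 P) ≠ 0 ∨
      evalQ (quadExp s ξ) (MvPolynomial.pderiv 1 P) ≠ 0) :
    expSum T (fun p => planeDot p u * signCoeff P s p) ξ ≠ 0 := by
  intro hcon
  have hdir : ∀ η : ℝ × ℝ, expSum T (fun p => planeDot p η * signCoeff P s p) ξ =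
      η.1 * expSum T (fun p => p.1 * signCoeff P s p) ξ +
      η.2 * expSum T (fun p => p.2 * signCoeff P s p) ξ := by
    intro η
    simp only [expSum, Finset.mul_sum, ← Finset.sum_add_distrib, planeDot, smul_eq_mul]
    exact Finset.sum_congr rfl fun p _ => by ring
  have hperp : expSum T (fun p => planeDot p (-u.2, u.1) * signCoeff P s p) ξ = 0 := by
    have : expSum T (fun p => planeDot p (-u.2, u.1) * signCoeff P s p) ξ =
        b * expSum T (signCoeff P s) ξ := by
      rw [expSum, expSum, Finset.mul_sum]
      refine Finset.sum_congr rfl fun p hp => ?_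
      rw [hline p hp, smul_eq_mul, smul_eq_mul]
      ring
    rw [this, h0, mul_zero]
  rw [hdir] at hcon hperp
  have hpos : u.1 * u.1 + u.2 * u.2 ≠ 0 := (planeDot_self_pos hu).ne'
  have h1 : expSum T (fun p => p.1 * signCoeff P s p) ξ = 0 :=
    (mul_eq_zero.1 (by linear_combination u.1 * hcon - u.2 * hperp :
      (u.1 * u.1 + u.2 * u.2) * _ = 0)).resolve_left hpos
  have h2 : expSum T (fun p => p.2 * signCoeff P s p) ξ = 0 :=
    (mul_eq_zero.1 (by linear_combination u.2 * hcon + u.1 * hperp :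
      (u.1 * u.1 + u.2 * u.2) * _ = 0)).resolve_left hpos
  have htorus := quadExp_mem_realTorus s ξ
  rcases hnd with h | h
  · exact mul_ne_zero htorus.1 h ((mul_evalQ_pderiv hT hP s ξ 0).trans h1)
  · exact mul_ne_zero htorus.2 h ((mul_evalQ_pderiv hT hP s ξ 1).trans h2)

lemma right_mem_extremePoints_segment {v w : ℝ × ℝ} :
    w ∈ (segment ℝ v w).extremePoints ℝ := by
  rcases eq_or_ne v w with rfl | hvw
  · simp
  refine ⟨right_mem_segment ℝ v w, ?_⟩
  have key : ∀ x ∈ segment ℝ v w, ∃ a : ℝ, 0 ≤ a ∧ x = w - a • (w - v) := by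
    rintro _ ⟨a, b, ha, -, hab, rfl⟩
    obtain rfl : b = 1 - a := by linarith
    exact ⟨a, ha, by module⟩
  intro x hx y hy hw
  obtain ⟨a, ha, rfl⟩ := key x hx
  obtain ⟨b, hb, rfl⟩ := key y hy
  obtain ⟨t, r, ht, hr, htr, h⟩ := hw
  obtain rfl : r = 1 - t := by linarith
  have h' : (t * a + (1 - t) * b) • (w - v) = 0 := by
    rw [← sub_eq_zero] at h
    rw [← neg_eq_zero, ← h]
    module
  have h0 := (smul_eq_zero.1 h').resolve_right (sub_ne_zero.2 hvw.symm)
  have : t * a = 0 := by nlinarith [mul_nonneg ht.le ha, mul_nonneg hr.le hb]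
  simp [(mul_eq_zero.1 this).resolve_left ht.ne']

/-- The end points of an edge of the Newton polygon are exponents of the polynomial. -/
lemma exists_mem_support_of_isExposed_segment {Q : MvPolynomial (Fin 2) ℝ} {v w : ℝ × ℝ}
    (h : IsExposed ℝ (newtonPolygon Q) (segment ℝ v w)) :
    ∃ d ∈ Q.support, exponentPoint d = w := by
  have hw := extremePoints_convexHull_subset
    (h.isExtreme.extremePoints_subset_extremePoints right_mem_extremePoints_segment)
  exact hw

lemma exponentPoint_mem_newtonPolygon {Q : MvPolynomial (Fin 2) ℝ} {d : Fin 2 →₀ ℕ}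
    (hd : d ∈ Q.support) : exponentPoint d ∈ newtonPolygon Q :=
  subset_convexHull ℝ _ ⟨d, hd, rfl⟩

lemma isCompact_newtonPolygon (Q : MvPolynomial (Fin 2) ℝ) : IsCompact (newtonPolygon Q) :=
  (Q.support.finite_toSet.image _).isCompact_convexHull ℝ

lemma newtonPolygon_nonneg {Q : MvPolynomial (Fin 2) ℝ} {p : ℝ × ℝ} (hp : p ∈ newtonPolygon Q) :
    0 ≤ p.1 ∧ 0 ≤ p.2 := by
  have : newtonPolygon Q ⊆ Set.Ici 0 := by
    refine convexHull_min ?_ (convex_Ici 0)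
    rintro _ ⟨d, -, rfl⟩
    exact ⟨Nat.cast_nonneg _, Nat.cast_nonneg _⟩
  exact this hp

/-- An edge of the Newton polygon is cut out by a supporting line. -/
lemma exists_planeDot_of_isExposed {Θ Λ : Set (ℝ × ℝ)} (h : IsExposed ℝ Θ Λ) {v : ℝ × ℝ}
    (hv : v ∈ Λ) :
    ∃ n : ℝ × ℝ, (∀ p ∈ Θ, planeDot p n ≤ planeDot v n) ∧
      ∀ p ∈ Θ, p ∈ Λ ↔ planeDot p n = planeDot v n := by
  obtain ⟨l, rfl⟩ := h ⟨v, hv⟩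
  have hl : ∀ p, l p = planeDot p (l (1, 0), l (0, 1)) := by
    intro p
    have : p = p.1 • ((1, 0) : ℝ × ℝ) + p.2 • ((0, 1) : ℝ × ℝ) := by ext <;> simp
    conv_lhs => rw [this, map_add, map_smul, map_smul]
    rfl
  refine ⟨(l (1, 0), l (0, 1)), fun p hp => ?_, fun p hp => ?_⟩
  · rw [← hl, ← hl]
    exact hv.2 p hp
  · rw [← hl, ← hl]
    exact ⟨fun h => le_antisymm (hv.2 p hp) (h.2 v hv.1), fun h => ⟨hp, fun y hy => h ▸ hv.2 y hy⟩⟩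

end Charts

/-- if `Q` is real nondegenerate with respect to its (two-dimensional) Newton
polygon `Θ`, then for every edge `Λ` of `Θ` one has `Ch_Θ(Q) ∩ Λ̃ = Ch_Λ(Q^Λ)`. -/
theorem chart_restriction_to_edge
    (Q : MvPolynomial (Fin 2) ℝ)
    (hdim : (interior (newtonPolygon Q)).Nonempty)
    (hnd : RealNonDeg Q (newtonPolygon Q))
    (Λ : Set (ℝ × ℝ))
    (hface : IsExposed ℝ (newtonPolygon Q) Λ)
    (hedge : ∃ v w : ℝ × ℝ, v ≠ w ∧ Λ = segment ℝ v w) :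
    chart (newtonPolygon Q) Q ∩ tildeSet Λ = chart Λ (trunc Q Λ) := by
  obtain ⟨v, w, hvw, rfl⟩ := hedge
  obtain ⟨dw, hdw, hdw'⟩ := exists_mem_support_of_isExposed_segment hface
  obtain ⟨dv, hdv, hdv'⟩ := exists_mem_support_of_isExposed_segment (segment_symm ℝ v w ▸ hface)
  set Λ := segment ℝ v w
  obtain ⟨n, hn, hΛn⟩ := exists_planeDot_of_isExposed hface (left_mem_segment ℝ v w)
  obtain ⟨T, hT⟩ := exists_latticeFinset (isCompact_newtonPolygon Q).isBounded
  have hΛΘ : Λ ⊆ newtonPolygon Q := hface.subset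
  have hΛnn : ∀ p ∈ Λ, 0 ≤ p.1 ∧ 0 ≤ p.2 := fun p hp => newtonPolygon_nonneg (hΛΘ hp)
  have hΛcompact : IsCompact Λ := hface.isCompact (isCompact_newtonPolygon Q)
  have hF : ∀ p, p ∈ T.filter (fun p => planeDot p n = planeDot v n) ↔
      p ∈ Λ ∧ p ∈ Set.range latticeEmb := by
    intro p
    rw [Finset.mem_filter, hT]
    exact ⟨fun h => ⟨(hΛn p h.1.1).2 h.2, h.1.2⟩,
      fun h => ⟨⟨hΛΘ h.1, h.2⟩, (hΛn p (hΛΘ h.1)).1 h.1⟩⟩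
  have hvF := (hF v).2 ⟨left_mem_segment ℝ v w, by rw [← hdv']; exact exponentPoint_mem_range dv⟩
  have hwF := (hF w).2 ⟨right_mem_segment ℝ v w, by rw [← hdw']; exact exponentPoint_mem_range dw⟩
  have hm : ∀ p ∈ T, planeDot p n ≤ planeDot v n := fun p hp => hn p ((hT p).1 hp).1
  have hFexp : ∀ p ∈ T.filter (fun p => planeDot p n = planeDot v n), ∃ d, exponentPoint d = p :=
    fun p hp => exists_exponentPoint ((hF p).1 hp).2 (hΛnn p ((hF p).1 hp).1)
  have hFsupp : ∀ d ∈ (trunc Q Λ).support,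
      exponentPoint d ∈ T.filter (fun p => planeDot p n = planeDot v n) := fun d hd =>
    (hF _).2 ⟨exponentPoint_mem_of_mem_support_trunc hd, exponentPoint_mem_range d⟩
  have hcoeff : ∀ s, ∀ p ∈ T.filter (fun p => planeDot p n = planeDot v n),
      signCoeff (trunc Q Λ) s p = signCoeff Q s p := by
    intro s p hp
    obtain ⟨d, rfl⟩ := hFexp p hp
    rw [signCoeff_exponentPoint, signCoeff_exponentPoint, coeff_trunc d ((hF _).1 hp).1]
  have hsum : ∀ s ξ, expSum (T.filter fun p => planeDot p n = planeDot v n)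
      (signCoeff (trunc Q Λ) s) ξ =
      expSum (T.filter fun p => planeDot p n = planeDot v n) (signCoeff Q s) ξ := fun s ξ =>
    Finset.sum_congr rfl fun p hp => by rw [hcoeff s p hp]
  rw [chart_eq_iUnion (fun p => newtonPolygon_nonneg) hT fun d => exponentPoint_mem_newtonPolygon,
    chart_eq_iUnion hΛnn hF fun d => exponentPoint_mem_of_mem_support_trunc]
  apply Set.Subset.antisymm
  · rintro _ ⟨hmem, hzΛ⟩
    obtain ⟨s, z, hz, rfl⟩ := Set.mem_iUnion.1 hmem
    have hzΘ : z ∈ newtonPolygon Q := by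
      refine closure_minimal ?_ (isCompact_newtonPolygon Q).isClosed hz
      rintro _ ⟨ξ, -, rfl⟩
      exact expMean_mem_convex ⟨v, (Finset.mem_filter.1 hvF).1⟩ (convex_convexHull ℝ _)
        (fun p hp => ((hT p).1 hp).1) ξ
    have hzΛ' : z ∈ Λ := mem_of_quadRefl_mem_tildeSet hΛnn (newtonPolygon_nonneg hzΘ) hzΛ
    obtain ⟨ξ, hξ, hξz⟩ := exists_zero_of_mem_closure hm hvw hvF hwF (fun p hp => ((hF p).1 hp).1)
      (hdv' ▸ signCoeff_exponentPoint_ne_zero hdv s)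
      (hdw' ▸ signCoeff_exponentPoint_ne_zero hdw s) ((hΛn z hzΘ).1 hzΛ') hz
    exact Set.mem_iUnion.2 ⟨s, z, subset_closure ⟨ξ, (hsum s ξ).trans hξ, hξz⟩, rfl⟩
  · refine Set.iUnion_subset fun s => ?_
    rintro _ ⟨z, hz, rfl⟩
    constructor
    · refine Set.mem_iUnion.2 ⟨s, z, closure_minimal ?_ isClosed_closure hz, rfl⟩
      rintro _ ⟨ξ, hξ, rfl⟩
      have hξ' : evalQ (quadExp s ξ) (trunc Q Λ) = 0 :=
        (evalQ_quadExp hFexp hFsupp s ξ).trans hξ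
      have hline : ∀ p ∈ T.filter (fun p => planeDot p n = planeDot v n),
          planeDot p (-(w - v).2, (w - v).1) = planeDot v (-(w - v).2, (w - v).1) := by
        intro p hp
        obtain ⟨a, b, -, -, hab, rfl⟩ := ((hF p).1 hp).1
        obtain rfl : b = 1 - a := by linarith
        simp only [planeDot, Prod.fst_add, Prod.snd_add, Prod.smul_fst, Prod.smul_snd,
          Prod.fst_sub, Prod.snd_sub, smul_eq_mul]
        ring
      refine expMean_face_mem_closure hm ⟨v, hvF⟩ (signCoeff Q s) (u := w - v)
        ((hsum s ξ).symm.trans hξ) ?_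
      have h := expSum_planeDot_ne_zero hFexp hFsupp (sub_ne_zero.2 hvw.symm) hline hξ
        (hnd Λ ⟨v, left_mem_segment ℝ v w⟩ hface _ (quadExp_mem_realTorus s ξ) hξ')
      convert h using 1
      exact Finset.sum_congr rfl fun p hp => by simp only [hcoeff s p hp]
    · refine Set.mem_iUnion.2 ⟨s, z, closure_minimal ?_ hΛcompact.isClosed hz, rfl⟩
      rintro _ ⟨ξ, -, rfl⟩
      exact expMean_mem_convex ⟨v, hvF⟩ (convex_segment v w) (fun p hp => ((hF p).1 hp).1) ξ
end
end

section
/- Let n and m be positive integers, e = gcd(n,m), Γ the segment from (m,0) to (0,n), and Δ the triangle with vertices (0,0), (m,0), (0,n). Then there exist a convex piecewise affine function ω : Δ → ℝ_{≥0} taking integer values on Δ ∩ ℤ² and vanishing on Γ ∩ ℤ², and a finite family of triangles T, T₁, …, T_N with vertices in Δ ∩ ℤ², covering Δ and with pairwise disjoint interiors, such that: ω is affine on each of T, T₁, …, T_N and these triangles are exactly the maximal closed subsets of Δ on which ω is affine; every lattice point of Δ \setminus Γ is a vertex of one of the triangles; T is the unique triangle of the family containing Γ as an edge, and T is the image of conv{(0,0),(e,0),(0,1)}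 under an affine map v ↦ Mv + w with M an integer matrix of determinant ±1 and w ∈ ℤ²; and each T_i (i = 1,…,N) is primitive, i.e. has area 1/2. -/
noncomputable section

/-- The closed lattice triangle spanned by three integral points. -/
def latticeTriangle (v : (ℤ × ℤ) × (ℤ × ℤ) × (ℤ × ℤ)) : Set (ℝ × ℝ) :=
  convexHull ℝ {latticeEmb v.1, latticeEmb v.2.1, latticeEmb v.2.2}

/-- `ω` is (restricted to `A`) an affine function of the coordinates. -/
def AffineOnSet (ω : ℝ × ℝ → ℝ) (A : Set (ℝ × ℝ)) : Prop :=
  ∃ a b c : ℝ, ∀ p ∈ A, ω p = a * p.1 + b * p.2 + c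

/-- Twice the signed area of the triangle `u v w`. -/
def orient (u v w : ℝ × ℝ) : ℝ :=
  (v.1 - u.1) * (w.2 - u.2) - (v.2 - u.2) * (w.1 - u.1)

/-- The value at `p` of the affine function with coefficients `L`. -/
def affEval (L : ℝ × ℝ × ℝ) (p : ℝ × ℝ) : ℝ := L.1 * p.1 + L.2.1 * p.2 + L.2.2

theorem mem_convexHull_triple {u v w p : ℝ × ℝ} :
    p ∈ convexHull ℝ {u, v, w} ↔ ∃ a b c : ℝ, 0 ≤ a ∧ 0 ≤ b ∧ 0 ≤ c ∧ a + b + c = 1 ∧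
      a * u.1 + b * v.1 + c * w.1 = p.1 ∧ a * u.2 + b * v.2 + c * w.2 = p.2 := by
  constructor
  · rw [convexHull_insert (Set.insert_nonempty _ _), convexHull_pair, mem_convexJoin]
    rintro ⟨x, rfl, y, ⟨a, b, ha, hb, hab, rfl⟩, ⟨c, d, hc, hd, hcd, rfl⟩⟩
    refine ⟨c, d * a, d * b, hc, by positivity, by positivity, ?_, ?_, ?_⟩
    · linear_combination hcd + d * hab
    · simp; ring
    · simp; ring
  · rintro ⟨a, b, c, ha, hb, hc, h, h1, h2⟩
    have hp : p = a • u + b • v + c • w := by ext <;> simp [h1, h2]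
    rw [hp]
    have hC := convex_convexHull ℝ ({u, v, w} : Set (ℝ × ℝ))
    have key := hC.sum_mem (t := Finset.univ) (w := ![a, b, c]) (z := ![u, v, w])
      (by intro i _; fin_cases i <;> simpa) (by simp [Fin.sum_univ_three, h])
      (by intro i _; fin_cases i <;> exact subset_convexHull ℝ _ (by simp))
    simpa [Fin.sum_univ_three] using key

theorem affEval_comb (L : ℝ × ℝ × ℝ) {u v w p : ℝ × ℝ} {a b c : ℝ} (h : a + b + c = 1)
    (h1 : a * u.1 + b * v.1 + c * w.1 = p.1) (h2 : a * u.2 + b * v.2 + c * w.2 = p.2) :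
    affEval L p = a * affEval L u + b * affEval L v + c * affEval L w := by
  unfold affEval
  rw [← h1, ← h2]
  linear_combination -L.2.2 * h

theorem orient_eq_of_comb {u v w p : ℝ × ℝ} {a b c : ℝ} (h : a + b + c = 1)
    (h1 : a * u.1 + b * v.1 + c * w.1 = p.1) (h2 : a * u.2 + b * v.2 + c * w.2 = p.2) :
    orient p v w = a * orient u v w ∧ orient u p w = b * orient u v w ∧
      orient u v p = c * orient u v w := by
  obtain rfl : a = 1 - b - c := by linear_combination h
  unfold orient
  rw [← h1, ← h2]
  refine ⟨?_, ?_, ?_⟩ <;> ring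

/-- Every point has barycentric coordinates with respect to a nondegenerate triangle. -/
theorem exists_barycentric {u v w : ℝ × ℝ} (h : orient u v w ≠ 0) (p : ℝ × ℝ) :
    ∃ a b c : ℝ, a + b + c = 1 ∧ a * u.1 + b * v.1 + c * w.1 = p.1 ∧
      a * u.2 + b * v.2 + c * w.2 = p.2 := by
  refine ⟨orient p v w / orient u v w, orient u p w / orient u v w, orient u v p / orient u v w,
    ?_, ?_, ?_⟩
  all_goals field_simp; unfold orient; ring

/-- The affine function interpolating given values at the vertices of a triangle. -/
def interpolate (u v w : ℝ × ℝ) (r s t : ℝ) : ℝ × ℝ × ℝ :=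
  (((v.2 - w.2) * r + (w.2 - u.2) * s + (u.2 - v.2) * t) / orient u v w,
   ((w.1 - v.1) * r + (u.1 - w.1) * s + (v.1 - u.1) * t) / orient u v w,
   ((v.1 * w.2 - v.2 * w.1) * r + (w.1 * u.2 - w.2 * u.1) * s +
     (u.1 * v.2 - u.2 * v.1) * t) / orient u v w)

theorem affEval_interpolate {u v w : ℝ × ℝ} (h : orient u v w ≠ 0) (r s t : ℝ) :
    affEval (interpolate u v w r s t) u = r ∧ affEval (interpolate u v w r s t) v = s ∧
      affEval (interpolate u v w r s t) w = t := by
  unfold affEval interpolate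
  refine ⟨?_, ?_, ?_⟩
  all_goals field_simp; unfold orient; ring

theorem eq_interpolate {u v w : ℝ × ℝ} (h : orient u v w ≠ 0) {L : ℝ × ℝ × ℝ} {r s t : ℝ}
    (hr : affEval L u = r) (hs : affEval L v = s) (ht : affEval L w = t) :
    L = interpolate u v w r s t := by
  obtain ⟨a, b, c⟩ := L
  subst hr hs ht
  simp only [interpolate, affEval, Prod.mk.injEq]
  refine ⟨?_, ?_, ?_⟩
  all_goals rw [eq_div_iff h]; unfold orient; ring

/-- An affine function is determined by its values on a nonempty open set. -/
theorem affEval_eq_of_eqOn_open {L L' : ℝ × ℝ × ℝ} {U : Set (ℝ × ℝ)} (hU : IsOpen U)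
    (hne : U.Nonempty) (h : ∀ p ∈ U, affEval L p = affEval L' p) : L = L' := by
  obtain ⟨⟨x, y⟩, hp⟩ := hne
  obtain ⟨ε, hε, hball⟩ := Metric.isOpen_iff.1 hU _ hp
  have hm : ∀ a b : ℝ, |a| < ε → |b| < ε → (x + a, y + b) ∈ U := by
    intro a b ha hb
    apply hball
    simp [Prod.dist_eq, ha, hb]
  have hε2 : |ε / 2| < ε := by rw [abs_of_pos (by positivity)]; linarith
  have h0 : |(0 : ℝ)| < ε := by simpa
  have e0 := h _ (hm 0 0 h0 h0)
  have e1 := h _ (hm (ε / 2) 0 hε2 h0)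
  have e2 := h _ (hm 0 (ε / 2) h0 hε2)
  obtain ⟨a, b, c⟩ := L
  obtain ⟨a', b', c'⟩ := L'
  simp only [affEval] at e0 e1 e2
  have ha : a = a' := by
    have : (a - a') * (ε / 2) = 0 := by linear_combination e1 - e0
    rcases mul_eq_zero.1 this with h | h <;> linarith
  have hb : b = b' := by
    have : (b - b') * (ε / 2) = 0 := by linear_combination e2 - e0
    rcases mul_eq_zero.1 this with h | h <;> linarith
  subst ha hb
  have : c = c' := by linear_combination e0
  rw [this]

theorem affineIndependent_of_orient_ne_zero {u v w : ℝ × ℝ} (h : orient u v w ≠ 0) :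
    AffineIndependent ℝ ![u, v, w] := by
  rw [affineIndependent_iff_of_fintype]
  intro f hf hs
  rw [Finset.weightedVSub_eq_linear_combination _ hf] at hs
  simp only [Fin.sum_univ_three, Prod.ext_iff] at hs hf
  simp at hs
  obtain ⟨h1, h2⟩ := hs
  have e0 : f 0 = - f 1 - f 2 := by linear_combination hf
  rw [e0] at h1 h2
  have e1 : f 1 = 0 := by
    have : f 1 * orient u v w = 0 := by
      unfold orient; linear_combination (w.2 - u.2) * h1 - (w.1 - u.1) * h2
    simpa [h] using this
  have e2 : f 2 = 0 := by
    have : f 2 * orient u v w = 0 := by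
      unfold orient; linear_combination (v.1 - u.1) * h2 - (v.2 - u.2) * h1
    simpa [h] using this
  intro i
  fin_cases i <;> simp [e0, e1, e2]

theorem interior_triangle_nonempty {u v w : ℝ × ℝ} (h : orient u v w ≠ 0) :
    (interior (convexHull ℝ {u, v, w})).Nonempty := by
  have hi := affineIndependent_of_orient_ne_zero h
  have := interior_convexHull_nonempty_iff_affineSpan_eq_top.2
    (hi.affineSpan_eq_top_iff_card_eq_finrank_add_one.2 (by simp))
  have hr : Set.range ![u, v, w] = {u, v, w} := by
    ext x; simp [eq_comm]; tauto
  rwa [hr] at this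

/-- The affine function interpolating the heights `H` at the vertices of a lattice triangle. -/
def facetPlane (H : ℤ × ℤ → ℝ) (t : (ℤ × ℤ) × (ℤ × ℤ) × (ℤ × ℤ)) : ℝ × ℝ × ℝ :=
  interpolate (latticeEmb t.1) (latticeEmb t.2.1) (latticeEmb t.2.2) (H t.1) (H t.2.1) (H t.2.2)

/-- A nondegenerate lattice triangle with vertices in `A`, together with the affine function
interpolating the heights `H` at its vertices. -/
structure IsLift (A : Finset (ℤ × ℤ)) (H : ℤ × ℤ → ℝ) (L : ℝ × ℝ × ℝ)
    (t : (ℤ × ℤ) × (ℤ × ℤ) × (ℤ × ℤ)) : Prop where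
  mem₁ : t.1 ∈ A
  mem₂ : t.2.1 ∈ A
  mem₃ : t.2.2 ∈ A
  nondeg : orient (latticeEmb t.1) (latticeEmb t.2.1) (latticeEmb t.2.2) ≠ 0
  eq₁ : affEval L (latticeEmb t.1) = H t.1
  eq₂ : affEval L (latticeEmb t.2.1) = H t.2.1
  eq₃ : affEval L (latticeEmb t.2.2) = H t.2.2

/-- A lifted triangle that is a facet of the lower convex hull of the graph of `H` on `A`. -/
structure IsLowerFacet (A : Finset (ℤ × ℤ)) (H : ℤ × ℤ → ℝ) (L : ℝ × ℝ × ℝ)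
    (t : (ℤ × ℤ) × (ℤ × ℤ) × (ℤ × ℤ)) : Prop extends IsLift A H L t where
  le : ∀ a ∈ A, affEval L (latticeEmb a) ≤ H a

/-- Convex heights such that no four lifted points are coplanar. -/
structure IsGenericConvex (A : Finset (ℤ × ℤ)) (H : ℤ × ℤ → ℝ) : Prop where
  convex : ∀ u ∈ A, ∀ v ∈ A, ∀ w ∈ A, ∀ q ∈ A, ∀ a b c : ℝ, 0 ≤ a → 0 ≤ b → 0 ≤ c →
    a + b + c = 1 → a * (u.1 : ℝ) + b * v.1 + c * w.1 = q.1 →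
    a * (u.2 : ℝ) + b * v.2 + c * w.2 = q.2 → H q ≤ a * H u + b * H v + c * H w
  generic : ∀ L t, IsLift A H L t → ∀ q ∈ A, affEval L (latticeEmb q) = H q →
    q = t.1 ∨ q = t.2.1 ∨ q = t.2.2

section LowerHull

variable {A : Finset (ℤ × ℤ)} {H : ℤ × ℤ → ℝ} {L L' : ℝ × ℝ × ℝ}
  {t t' : (ℤ × ℤ) × (ℤ × ℤ) × (ℤ × ℤ)}

theorem IsLift.eq_facetPlane (h : IsLift A H L t) : L = facetPlane H t :=
  eq_interpolate h.nondeg h.eq₁ h.eq₂ h.eq₃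

theorem isLift_facetPlane (h1 : t.1 ∈ A) (h2 : t.2.1 ∈ A) (h3 : t.2.2 ∈ A)
    (h : orient (latticeEmb t.1) (latticeEmb t.2.1) (latticeEmb t.2.2) ≠ 0) :
    IsLift A H (facetPlane H t) t :=
  have e := affEval_interpolate h (H t.1) (H t.2.1) (H t.2.2)
  ⟨h1, h2, h3, h, e.1, e.2.1, e.2.2⟩

theorem IsLift.ext_of_eq (h : IsLift A H L t) (h1 : affEval L' (latticeEmb t.1) = H t.1)
    (h2 : affEval L' (latticeEmb t.2.1) = H t.2.1)
    (h3 : affEval L' (latticeEmb t.2.2) = H t.2.2) : L' = L :=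
  (eq_interpolate h.nondeg h1 h2 h3).trans (eq_interpolate h.nondeg h.eq₁ h.eq₂ h.eq₃).symm

/-- A step of the simplex method: keep a convex combination nonnegative while moving towards a new
point until one coefficient vanishes. -/
theorem exists_pivot {a b c x y z : ℝ} (ha : 0 < a) (hb : 0 < b) (hc : 0 < c)
    (h : x + y + z = 1) : ∃ s > 0, 0 ≤ a - s * x ∧ 0 ≤ b - s * y ∧ 0 ≤ c - s * z ∧
      ((x ≠ 0 ∧ a - s * x = 0) ∨ (y ≠ 0 ∧ b - s * y = 0) ∨ (z ≠ 0 ∧ c - s * z = 0)) := by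
  set r := max (x / a) (max (y / b) (z / c)) with hr
  have hxr : x / a ≤ r := le_max_left _ _
  have hyr : y / b ≤ r := (le_max_left _ _).trans (le_max_right _ _)
  have hzr : z / c ≤ r := (le_max_right _ _).trans (le_max_right _ _)
  have hx : x ≤ r * a := (div_le_iff₀ ha).1 hxr
  have hy : y ≤ r * b := (div_le_iff₀ hb).1 hyr
  have hz : z ≤ r * c := (div_le_iff₀ hc).1 hzr
  have hr0 : 0 < r := by
    by_contra hneg
    push Not at hneg
    have := mul_nonpos_of_nonpos_of_nonneg hneg ha.le
    have := mul_nonpos_of_nonpos_of_nonneg hneg hb.le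
    have := mul_nonpos_of_nonpos_of_nonneg hneg hc.le
    linarith
  have nonneg : ∀ {a x : ℝ}, x ≤ r * a → 0 ≤ a - 1 / r * x := by
    intro a x h
    have : 1 / r * x ≤ a := by rw [one_div, inv_mul_le_iff₀ hr0]; exact h
    linarith
  have vanish : ∀ {a x : ℝ}, 0 < a → r = x / a → x ≠ 0 ∧ a - 1 / r * x = 0 := by
    intro a x ha h
    have hx : x = r * a := by rw [h]; field_simp
    refine ⟨by rw [hx]; positivity, ?_⟩
    rw [hx]; field_simp; ring
  refine ⟨1 / r, by positivity, nonneg hx, nonneg hy, nonneg hz, ?_⟩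
  rcases max_choice (x / a) (max (y / b) (z / c)) with h1 | h1
  · exact Or.inl (vanish ha (hr.trans h1))
  · rcases max_choice (y / b) (z / c) with h2 | h2
    · exact Or.inr (Or.inl (vanish hb (hr.trans (h1.trans h2))))
    · exact Or.inr (Or.inr (vanish hc (hr.trans (h1.trans h2))))

theorem exists_isLowerFacet_of_generic {p : ℝ × ℝ}
    (hp : ∀ a ∈ A, ∀ b ∈ A, a ≠ b → orient (latticeEmb a) (latticeEmb b) p ≠ 0)
    (h0 : IsLift A H L t) (hpt : p ∈ latticeTriangle t) :
    ∃ L' t', IsLowerFacet A H L' t' ∧ p ∈ latticeTriangle t' := by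
  set S : Set ((ℤ × ℤ) × (ℤ × ℤ) × (ℤ × ℤ)) :=
    {t | IsLift A H (facetPlane H t) t ∧ p ∈ latticeTriangle t} with hS
  have hfin : S.Finite := by
    refine (A ×ˢ A ×ˢ A).finite_toSet.subset ?_
    rintro t ⟨ht, -⟩
    simp [ht.mem₁, ht.mem₂, ht.mem₃]
  obtain ⟨t₁, ⟨hl, hpt₁⟩, hmin⟩ := Set.exists_min_image S (fun t => affEval (facetPlane H t) p)
    hfin ⟨t, by rw [hS, Set.mem_ofPred_eq, ← h0.eq_facetPlane]; exact ⟨h0, hpt⟩⟩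
  refine ⟨_, t₁, ⟨hl, ?_⟩, hpt₁⟩
  intro q hq
  by_contra! hlt
  have hn := hl.nondeg
  obtain ⟨a, b, c, ha, hb, hc, habc, e1, e2⟩ := mem_convexHull_triple.1 hpt₁
  have hab := affEval_comb (facetPlane H t₁) habc e1 e2
  rw [hl.eq₁, hl.eq₂, hl.eq₃] at hab
  obtain ⟨o1, o2, o3⟩ := orient_eq_of_comb habc e1 e2
  have ne12 : t₁.1 ≠ t₁.2.1 := fun h => hn (by rw [h]; unfold orient; ring)
  have ne13 : t₁.1 ≠ t₁.2.2 := fun h => hn (by rw [h]; unfold orient; ring)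
  have ne23 : t₁.2.1 ≠ t₁.2.2 := fun h => hn (by rw [h]; unfold orient; ring)
  have ha' : 0 < a := lt_of_le_of_ne ha (by
    rintro rfl
    exact hp _ hl.mem₂ _ hl.mem₃ ne23 (by rw [zero_mul] at o1; rw [← o1]; unfold orient; ring))
  have hb' : 0 < b := lt_of_le_of_ne hb (by
    rintro rfl
    exact hp _ hl.mem₃ _ hl.mem₁ ne13.symm
      (by rw [zero_mul] at o2; rw [← o2]; unfold orient; ring))
  have hc' : 0 < c := lt_of_le_of_ne hc (by
    rintro rfl
    exact hp _ hl.mem₁ _ hl.mem₂ ne12 (by rw [zero_mul] at o3; rw [← o3]))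
  obtain ⟨x, y, z, hxyz, f1, f2⟩ := exists_barycentric hn (latticeEmb q)
  have hqe := affEval_comb (facetPlane H t₁) hxyz f1 f2
  rw [hl.eq₁, hl.eq₂, hl.eq₃] at hqe
  obtain ⟨q1, q2, q3⟩ := orient_eq_of_comb hxyz f1 f2
  obtain ⟨s, hs, sa, sb, sc, hcase⟩ := exists_pivot ha' hb' hc' hxyz
  have descend : ∀ (t' : (ℤ × ℤ) × (ℤ × ℤ) × (ℤ × ℤ)), t'.1 ∈ A → t'.2.1 ∈ A → t'.2.2 ∈ A →
      orient (latticeEmb t'.1) (latticeEmb t'.2.1) (latticeEmb t'.2.2) ≠ 0 →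
      ∀ a' b' c' : ℝ, 0 ≤ a' → 0 ≤ b' → 0 ≤ c' → a' + b' + c' = 1 →
      a' * (latticeEmb t'.1).1 + b' * (latticeEmb t'.2.1).1 + c' * (latticeEmb t'.2.2).1 = p.1 →
      a' * (latticeEmb t'.1).2 + b' * (latticeEmb t'.2.1).2 + c' * (latticeEmb t'.2.2).2 = p.2 →
      a' * H t'.1 + b' * H t'.2.1 + c' * H t'.2.2 <
        a * H t₁.1 + b * H t₁.2.1 + c * H t₁.2.2 → False := by
    intro t' m1 m2 m3 hne a' b' c' ha hb hc h g1 g2 hlt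
    have hl' := isLift_facetPlane (H := H) m1 m2 m3 hne
    have hv := affEval_comb (facetPlane H t') h g1 g2
    rw [hl'.eq₁, hl'.eq₂, hl'.eq₃] at hv
    have := hmin t' ⟨hl', mem_convexHull_triple.2 ⟨a', b', c', ha, hb, hc, h, g1, g2⟩⟩
    simp only [hv, hab] at this
    linarith
  have hgain : s * H q < s * (x * H t₁.1 + y * H t₁.2.1 + z * H t₁.2.2) := by
    rw [← hqe]; exact mul_lt_mul_of_pos_left hlt hs
  rcases hcase with ⟨hx, hz⟩ | ⟨hx, hz⟩ | ⟨hx, hz⟩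
  · refine descend (q, t₁.2.1, t₁.2.2) hq hl.mem₂ hl.mem₃ (by rw [q1]; exact mul_ne_zero hx hn)
      s _ _ hs.le sb sc ?_ ?_ ?_ ?_
    · linear_combination habc - s * hxyz - hz
    · linear_combination e1 - s * f1 - (latticeEmb t₁.1).1 * hz
    · linear_combination e2 - s * f2 - (latticeEmb t₁.1).2 * hz
    · linear_combination hgain - H t₁.1 * hz
  · refine descend (t₁.1, q, t₁.2.2) hl.mem₁ hq hl.mem₃ (by rw [q2]; exact mul_ne_zero hx hn)
      _ s _ sa hs.le sc ?_ ?_ ?_ ?_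
    · linear_combination habc - s * hxyz - hz
    · linear_combination e1 - s * f1 - (latticeEmb t₁.2.1).1 * hz
    · linear_combination e2 - s * f2 - (latticeEmb t₁.2.1).2 * hz
    · linear_combination hgain - H t₁.2.1 * hz
  · refine descend (t₁.1, t₁.2.1, q) hl.mem₁ hl.mem₂ hq (by rw [q3]; exact mul_ne_zero hx hn)
      _ _ s sa sb hs.le ?_ ?_ ?_ ?_
    · linear_combination habc - s * hxyz - hz
    · linear_combination e1 - s * f1 - (latticeEmb t₁.2.2).1 * hz
    · linear_combination e2 - s * f2 - (latticeEmb t₁.2.2).2 * hz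
    · linear_combination hgain - H t₁.2.2 * hz

theorem isClosed_latticeTriangle (t : (ℤ × ℤ) × (ℤ × ℤ) × (ℤ × ℤ)) :
    IsClosed (latticeTriangle t) :=
  Set.Finite.isClosed_convexHull ℝ (Set.toFinite _)

theorem convex_latticeTriangle (t : (ℤ × ℤ) × (ℤ × ℤ) × (ℤ × ℤ)) :
    Convex ℝ (latticeTriangle t) := convex_convexHull ℝ _

theorem finite_setOf_isLowerFacet (A : Finset (ℤ × ℤ)) (H : ℤ × ℤ → ℝ) :
    {t | ∃ L, IsLowerFacet A H L t}.Finite := by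
  refine (A ×ˢ A ×ˢ A).finite_toSet.subset ?_
  rintro t ⟨L, ht⟩
  simp [ht.mem₁, ht.mem₂, ht.mem₃]

theorem isOpen_orient_ne_zero (u v : ℝ × ℝ) : IsOpen {p | orient u v p ≠ 0} := by
  refine isOpen_ne_fun ?_ continuous_const
  unfold orient; fun_prop

theorem dense_orient_ne_zero {u v : ℝ × ℝ} (h : u ≠ v) : Dense {p | orient u v p ≠ 0} := by
  have hi : interior {p | orient u v p = 0} = ∅ := by
    by_contra hne
    have hL := affEval_eq_of_eqOn_open (L := (u.2 - v.2, v.1 - u.1,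
      (v.2 - u.2) * u.1 - (v.1 - u.1) * u.2)) (L' := 0) isOpen_interior
      (Set.nonempty_iff_ne_empty.2 hne) (fun p hp => by
        have h0 := interior_subset hp
        rw [Set.mem_ofPred_eq] at h0
        unfold orient at h0
        simp only [affEval, Prod.fst_zero, Prod.snd_zero]
        linear_combination h0)
    simp only [Prod.ext_iff, Prod.fst_zero, Prod.snd_zero] at hL
    exact h (Prod.ext (by linarith [hL.2.1]) (by linarith [hL.1]))
  exact interior_eq_empty_iff_dense_compl.1 hi

/-- The lower facets cover the convex hull. -/
theorem exists_isLowerFacet {p : ℝ × ℝ} (h0 : IsLift A H L t) (hpt : p ∈ latticeTriangle t) :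
    ∃ L' t', IsLowerFacet A H L' t' ∧ p ∈ latticeTriangle t' := by
  set C : Set (ℝ × ℝ) := ⋃ t ∈ {t | ∃ L, IsLowerFacet A H L t}, latticeTriangle t with hC
  have hclosed : IsClosed C := (finite_setOf_isLowerFacet A H).isClosed_biUnion
    fun t _ => isClosed_latticeTriangle t
  set D : Set (ℝ × ℝ) := ⋂ x ∈ {x : (ℤ × ℤ) × (ℤ × ℤ) | x.1 ≠ x.2},
    {p | orient (latticeEmb x.1) (latticeEmb x.2) p ≠ 0} with hD
  have hdense : Dense D := by
    refine dense_biInter_of_isOpen (fun _ _ => isOpen_orient_ne_zero _ _) (Set.to_countable _) ?_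
    rintro ⟨a, b⟩ hab
    refine dense_orient_ne_zero fun h => hab ?_
    simpa [latticeEmb, Prod.ext_iff] using h
  have hsub : interior (latticeTriangle t) ∩ D ⊆ C := by
    rintro q ⟨hq, hqD⟩
    simp only [hD, Set.mem_iInter] at hqD
    obtain ⟨L', t', h1, h2⟩ := exists_isLowerFacet_of_generic
      (fun a _ b _ hab => hqD (a, b) hab) h0 (interior_subset hq)
    exact Set.mem_biUnion ⟨L', h1⟩ h2
  have h1 : latticeTriangle t ⊆ closure (interior (latticeTriangle t)) := by
    rw [(convex_latticeTriangle t).closure_interior_eq_closure_of_nonempty_interior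
      (interior_triangle_nonempty h0.nondeg)]
    exact subset_closure
  have h2 := closure_minimal (hdense.open_subset_closure_inter
    (isOpen_interior (s := latticeTriangle t))) isClosed_closure
  have h3 := closure_minimal hsub hclosed
  obtain ⟨t', ⟨L', hL'⟩, ht'⟩ := Set.mem_iUnion₂.1 (h3 (h2 (h1 hpt)))
  exact ⟨L', t', hL', ht'⟩

theorem IsLowerFacet.affEval_le_of_mem (h : IsLowerFacet A H L t) (h' : IsLowerFacet A H L' t')
    {p : ℝ × ℝ} (hp : p ∈ latticeTriangle t) : affEval L' p ≤ affEval L p := by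
  obtain ⟨a, b, c, ha, hb, hc, habc, e1, e2⟩ := mem_convexHull_triple.1 hp
  rw [affEval_comb L habc e1 e2, affEval_comb L' habc e1 e2, h.eq₁, h.eq₂, h.eq₃]
  have := h'.le _ h.mem₁
  have := h'.le _ h.mem₂
  have := h'.le _ h.mem₃
  gcongr

theorem latticeEmb_mem_of_eq {q : ℤ × ℤ} (h : q = t.1 ∨ q = t.2.1 ∨ q = t.2.2) :
    latticeEmb q ∈ latticeTriangle t :=
  subset_convexHull ℝ _ (by rcases h with rfl | rfl | rfl <;> simp)

/-- The triangle of a lower facet is the contact locus of its affine function. -/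
theorem IsLowerFacet.mem_of_affEval_eq (hg : IsGenericConvex A H) (h : IsLowerFacet A H L t)
    (h' : IsLowerFacet A H L' t') {p : ℝ × ℝ} (hp : p ∈ latticeTriangle t')
    (he : affEval L p = affEval L' p) : p ∈ latticeTriangle t := by
  obtain ⟨a, b, c, ha, hb, hc, habc, e1, e2⟩ := mem_convexHull_triple.1 hp
  rw [affEval_comb L habc e1 e2, affEval_comb L' habc e1 e2, h'.eq₁, h'.eq₂, h'.eq₃] at he
  have l1 := h.le _ h'.mem₁
  have l2 := h.le _ h'.mem₂
  have l3 := h.le _ h'.mem₃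
  have m1 := mul_le_mul_of_nonneg_left l1 ha
  have m2 := mul_le_mul_of_nonneg_left l2 hb
  have m3 := mul_le_mul_of_nonneg_left l3 hc
  have vertex : ∀ (r : ℝ) (v : ℤ × ℤ), v ∈ A → r * affEval L (latticeEmb v) = r * H v →
      r ≠ 0 → latticeEmb v ∈ latticeTriangle t := fun r v hv hr hne =>
    latticeEmb_mem_of_eq (hg.generic L t h.toIsLift v hv (mul_left_cancel₀ hne hr))
  have v1 := vertex a _ h'.mem₁ (by linarith)
  have v2 := vertex b _ h'.mem₂ (by linarith)
  have v3 := vertex c _ h'.mem₃ (by linarith)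
  obtain ⟨v₀, hv₀⟩ : ∃ v₀, v₀ ∈ latticeTriangle t := ⟨_, latticeEmb_mem_of_eq (Or.inl rfl)⟩
  have adjust : ∀ (r : ℝ) (v : ℝ × ℝ), (r ≠ 0 → v ∈ latticeTriangle t) →
      ∃ v' ∈ latticeTriangle t, r • v' = r • v := by
    intro r v hv
    by_cases hr : r = 0
    · exact ⟨v₀, hv₀, by simp [hr]⟩
    · exact ⟨v, hv hr, rfl⟩
  obtain ⟨x, hx, ex⟩ := adjust a _ v1
  obtain ⟨y, hy, ey⟩ := adjust b _ v2
  obtain ⟨z, hz, ez⟩ := adjust c _ v3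
  have key := (convex_latticeTriangle t).sum_mem (t := Finset.univ) (w := ![a, b, c])
    (z := ![x, y, z]) (by intro i _; fin_cases i <;> simpa) (by simp [Fin.sum_univ_three, habc])
    (by intro i _; fin_cases i <;> simpa)
  simp only [Fin.sum_univ_three, Matrix.cons_val] at key
  rw [ex, ey, ez] at key
  convert key using 1
  ext <;> simp [e1, e2]

theorem IsLowerFacet.eq_vertex_of_mem (hg : IsGenericConvex A H) (h : IsLowerFacet A H L t)
    {q : ℤ × ℤ} (hq : q ∈ A) (hqt : latticeEmb q ∈ latticeTriangle t) :
    q = t.1 ∨ q = t.2.1 ∨ q = t.2.2 := by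
  obtain ⟨a, b, c, ha, hb, hc, habc, e1, e2⟩ := mem_convexHull_triple.1 hqt
  refine hg.generic L t h.toIsLift q hq (le_antisymm (h.le q hq) ?_)
  rw [affEval_comb L habc e1 e2, h.eq₁, h.eq₂, h.eq₃]
  exact hg.convex _ h.mem₁ _ h.mem₂ _ h.mem₃ _ hq a b c ha hb hc habc e1 e2

end LowerHull

theorem Set.Finite.exists_fin_enumeration {α : Type*} {S : Set α} (hS : S.Finite) {x : α}
    (hx : x ∈ S) :
    ∃ (N : ℕ) (f : Fin (N + 1) → α), Function.Injective f ∧ Set.range f = S ∧ f 0 = x := by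
  have : Finite S := hS
  have : Nonempty S := ⟨⟨x, hx⟩⟩
  obtain ⟨N, ⟨e⟩⟩ := Finite.exists_equiv_fin S
  obtain ⟨N, rfl⟩ : ∃ M, N = M + 1 :=
    Nat.exists_eq_succ_of_ne_zero (by rintro rfl; exact (e ⟨x, hx⟩).elim0)
  refine ⟨N, fun i => (e.symm (Equiv.swap 0 (e ⟨x, hx⟩) i) : S), ?_, ?_, by simp⟩
  · exact Subtype.val_injective.comp (e.symm.injective.comp (Equiv.injective _))
  · ext y
    constructor
    · rintro ⟨i, rfl⟩
      exact Subtype.coe_prop _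
    · intro hy
      exact ⟨Equiv.swap 0 (e ⟨x, hx⟩) (e ⟨y, hy⟩), by simp⟩

/-- Generic convex heights on a finite set of lattice points induce a regular triangulation. -/
theorem exists_regular_triangulation {A : Finset (ℤ × ℤ)} {H : ℤ × ℤ → ℝ} {L₀ LT : ℝ × ℝ × ℝ}
    {t₀ tT : (ℤ × ℤ) × (ℤ × ℤ) × (ℤ × ℤ)} (hg : IsGenericConvex A H) (h₀ : IsLift A H L₀ t₀)
    (hA : ∀ a ∈ A, latticeEmb a ∈ latticeTriangle t₀) (hT : IsLowerFacet A H LT tT) :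
    ∃ (ω : ℝ × ℝ → ℝ) (N : ℕ) (V : Fin (N + 1) → (ℤ × ℤ) × (ℤ × ℤ) × (ℤ × ℤ))
      (L : Fin (N + 1) → ℝ × ℝ × ℝ),
      V 0 = tT ∧ L 0 = LT ∧ Function.Injective L ∧ (∀ i, IsLowerFacet A H (L i) (V i)) ∧
      (∀ i, ∀ p ∈ latticeTriangle (V i), ω p = affEval (L i) p) ∧
      ConvexOn ℝ Set.univ ω ∧ (⋃ i, latticeTriangle (V i)) = latticeTriangle t₀ ∧
      (∀ i j, i ≠ j →
        interior (latticeTriangle (V i)) ∩ interior (latticeTriangle (V j)) = ∅) ∧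
      (∀ B : Set (ℝ × ℝ), Convex ℝ B → B ⊆ latticeTriangle t₀ → AffineOnSet ω B →
        ∃ i, B ⊆ latticeTriangle (V i)) ∧
      (∀ i, ∀ B : Set (ℝ × ℝ), B ⊆ latticeTriangle t₀ → AffineOnSet ω B →
        latticeTriangle (V i) ⊆ B → B = latticeTriangle (V i)) := by
  set S : Set (ℝ × ℝ × ℝ) := {L | ∃ t, IsLowerFacet A H L t} with hS
  have hfin : S.Finite := by
    refine ((finite_setOf_isLowerFacet A H).image (facetPlane H)).subset ?_
    rintro L ⟨t, ht⟩
    exact ⟨t, ⟨L, ht⟩, ht.eq_facetPlane.symm⟩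
  obtain ⟨N, L, hinj, hrange, hL0⟩ := hfin.exists_fin_enumeration (x := LT) ⟨tT, hT⟩
  have hex : ∀ i, ∃ t, IsLowerFacet A H (L i) t ∧ (i = 0 → t = tT) := by
    intro i
    by_cases hi : i = 0
    · subst hi
      exact ⟨tT, hL0 ▸ hT, fun _ => rfl⟩
    · obtain ⟨t, ht⟩ : L i ∈ S := hrange ▸ Set.mem_range_self i
      exact ⟨t, ht, fun h => absurd h hi⟩
  choose V hV hV0 using hex
  have hcover : (⋃ i, latticeTriangle (V i)) = latticeTriangle t₀ := by
    apply Set.Subset.antisymm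
    · refine Set.iUnion_subset fun i => convexHull_min ?_ (convex_latticeTriangle _)
      rintro _ (rfl | rfl | rfl)
      exacts [hA _ (hV i).mem₁, hA _ (hV i).mem₂, hA _ (hV i).mem₃]
    · intro p hp
      obtain ⟨L', t', hf, hp'⟩ := exists_isLowerFacet h₀ hp
      obtain ⟨i, rfl⟩ : L' ∈ Set.range L := hrange ▸ ⟨t', hf⟩
      exact Set.mem_iUnion.2 ⟨i, (hV i).mem_of_affEval_eq hg hf hp' rfl⟩
  set ω : ℝ × ℝ → ℝ := fun p =>
    Finset.univ.sup' Finset.univ_nonempty (fun i => affEval (L i) p) with hω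
  have hle : ∀ i p, affEval (L i) p ≤ ω p := fun i p =>
    Finset.le_sup' (fun i => affEval (L i) p) (Finset.mem_univ i)
  have hωeq : ∀ i, ∀ p ∈ latticeTriangle (V i), ω p = affEval (L i) p := fun i p hp =>
    le_antisymm (Finset.sup'_le _ _ fun j _ => (hV i).affEval_le_of_mem (hV j) hp) (hle i p)
  refine ⟨ω, N, V, L, hV0 0 rfl, hL0, hinj, hV, hωeq, ?_, hcover, ?_, ?_, ?_⟩
  · refine ⟨convex_univ, fun p _ q _ a b ha hb hab => Finset.sup'_le _ _ fun i _ => ?_⟩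
    have : affEval (L i) (a • p + b • q) = a * affEval (L i) p + b * affEval (L i) q := by
      simp only [affEval, Prod.fst_add, Prod.snd_add, Prod.smul_fst, Prod.smul_snd, smul_eq_mul]
      linear_combination -(L i).2.2 * hab
    rw [this]
    exact add_le_add (mul_le_mul_of_nonneg_left (hle i p) ha)
      (mul_le_mul_of_nonneg_left (hle i q) hb)
  · intro i j hij
    by_contra hne
    refine hij (hinj (affEval_eq_of_eqOn_open (isOpen_interior.inter isOpen_interior)
      (Set.nonempty_iff_ne_empty.2 hne) fun p hp => ?_))
    rw [← hωeq i p (interior_subset hp.1), ← hωeq j p (interior_subset hp.2)]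
  · rintro B hB hsub ⟨a, b, c, hab⟩
    by_contra! hnot
    have hstrict : ∀ i, ∃ p ∈ B, affEval (L i) p < ω p := by
      intro i
      obtain ⟨p, hpB, hp⟩ := Set.not_subset.1 (hnot i)
      refine ⟨p, hpB, lt_of_le_of_ne (hle i p) fun he => hp ?_⟩
      obtain ⟨j, hj⟩ := Set.mem_iUnion.1 (hcover ▸ hsub hpB)
      exact (hV i).mem_of_affEval_eq hg (hV j) hj (he.trans (hωeq j p hj))
    choose p hpB hp using hstrict
    set q : ℝ × ℝ := ∑ i, (1 / (N + 1 : ℝ)) • p i with hq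
    have hsum : ∑ _i : Fin (N + 1), (1 / (N + 1 : ℝ)) = 1 := by
      simp; field_simp
    have hqB : q ∈ B := hB.sum_mem (fun _ _ => by positivity) hsum fun i _ => hpB i
    have hav : ∀ K : ℝ × ℝ × ℝ, affEval K q = ∑ i, (1 / (N + 1 : ℝ)) * affEval K (p i) := by
      intro K
      have h1 : q.1 = ∑ i, (1 / (N + 1 : ℝ)) * (p i).1 := by simp [hq, Prod.fst_sum]
      have h2 : q.2 = ∑ i, (1 / (N + 1 : ℝ)) * (p i).2 := by simp [hq, Prod.snd_sum]
      unfold affEval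
      have h3 : K.2.2 = ∑ _i : Fin (N + 1), (1 / (N + 1 : ℝ)) * K.2.2 := by
        rw [← Finset.sum_mul, hsum, one_mul]
      rw [h1, h2]
      nth_rewrite 1 [h3]
      rw [Finset.mul_sum, Finset.mul_sum, ← Finset.sum_add_distrib, ← Finset.sum_add_distrib]
      exact Finset.sum_congr rfl fun i _ => by ring
    obtain ⟨j, hj⟩ := Set.mem_iUnion.1 (hcover ▸ hsub hqB)
    have hωq : ω q = affEval (a, b, c) q := hab q hqB
    have hlt : affEval (L j) q < affEval (a, b, c) q := by
      rw [hav, hav]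
      have hp' : ∀ i, ω (p i) = affEval (a, b, c) (p i) := fun i => hab _ (hpB i)
      refine Finset.sum_lt_sum (fun i _ => ?_) ⟨j, Finset.mem_univ j, ?_⟩
      · rw [← hp']
        exact mul_le_mul_of_nonneg_left (hle j _) (by positivity)
      · rw [← hp']
        exact mul_lt_mul_of_pos_left (hp j) (by positivity)
    exact hlt.ne (by rw [← hωq, hωeq j q hj])
  · rintro i B hsub ⟨a, b, c, hab⟩ hiB
    refine Set.Subset.antisymm (fun p hp => ?_) hiB
    have hvert : ∀ v, v = (V i).1 ∨ v = (V i).2.1 ∨ v = (V i).2.2 →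
        affEval (a, b, c) (latticeEmb v) = affEval (L i) (latticeEmb v) := by
      intro v hv
      have hm := latticeEmb_mem_of_eq hv
      rw [← hωeq i _ hm, hab _ (hiB hm)]
      rfl
    have hL : (a, b, c) = L i := (hV i).toIsLift.ext_of_eq
      ((hvert _ (by simp)).trans (hV i).eq₁) ((hvert _ (by simp)).trans (hV i).eq₂)
      ((hvert _ (by simp)).trans (hV i).eq₃)
    obtain ⟨j, hj⟩ := Set.mem_iUnion.1 (hcover ▸ hsub hp)
    refine (hV i).mem_of_affEval_eq hg (hV j) hj ?_
    rw [← hL, ← hωeq j p hj, hab p hp]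
    rfl

/-- Twice the signed area of a lattice triangle. -/
def latticeDet (u v w : ℤ × ℤ) : ℤ :=
  (v.1 - u.1) * (w.2 - u.2) - (v.2 - u.2) * (w.1 - u.1)

theorem orient_latticeEmb (u v w : ℤ × ℤ) :
    orient (latticeEmb u) (latticeEmb v) (latticeEmb w) = (latticeDet u v w : ℝ) := by
  simp [orient, latticeDet, latticeEmb]

/-- A lattice triangle whose only lattice points are its vertices is primitive. -/
theorem latticeDet_eq_of_empty {u v w : ℤ × ℤ} (hD : latticeDet u v w ≠ 0)
    (hempty : ∀ q, latticeEmb q ∈ latticeTriangle (u, v, w) → q = u ∨ q = v ∨ q = w) :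
    latticeDet u v w = 1 ∨ latticeDet u v w = -1 := by
  have hDR : (latticeDet u v w : ℝ) ≠ 0 := by exact_mod_cast hD
  have unique : ∀ s t s' t' : ℝ,
      s * (v.1 - u.1) + t * (w.1 - u.1) = s' * (v.1 - u.1) + t' * (w.1 - u.1) →
      s * (v.2 - u.2) + t * (w.2 - u.2) = s' * (v.2 - u.2) + t' * (w.2 - u.2) →
      s = s' ∧ t = t' := by
    intro s t s' t' h1 h2
    constructor
    · apply mul_left_cancel₀ hDR
      simp only [latticeDet]; push_cast
      linear_combination (w.2 - u.2 : ℝ) * h1 - (w.1 - u.1 : ℝ) * h2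
    · apply mul_left_cancel₀ hDR
      simp only [latticeDet]; push_cast
      linear_combination (v.1 - u.1 : ℝ) * h2 - (v.2 - u.2 : ℝ) * h1
  have vertex : ∀ (y : ℤ × ℤ) (s t : ℝ), 0 ≤ s → 0 ≤ t → s + t ≤ 1 →
      (y.1 : ℝ) = s * (v.1 - u.1) + t * (w.1 - u.1) →
      (y.2 : ℝ) = s * (v.2 - u.2) + t * (w.2 - u.2) →
      (s = 0 ∧ t = 0) ∨ s = 1 ∨ t = 1 := by
    intro y s t hs ht hst h1 h2
    have hmem : latticeEmb (u + y) ∈ latticeTriangle (u, v, w) := by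
      refine mem_convexHull_triple.2 ⟨1 - s - t, s, t, by linarith, hs, ht, by ring, ?_, ?_⟩
      · simp only [latticeEmb, Prod.fst_add]; push_cast; rw [h1]; ring
      · simp only [latticeEmb, Prod.snd_add]; push_cast; rw [h2]; ring
    rcases hempty _ hmem with h | h | h
    · have hy : y = 0 := by simpa using h
      rw [hy] at h1 h2
      exact Or.inl (unique s t 0 0 (by rw [← h1]; simp) (by rw [← h2]; simp))
    · obtain rfl : y = v - u := by rw [← h]; simp
      simp only [Prod.fst_sub, Prod.snd_sub, Int.cast_sub] at h1 h2
      exact Or.inr (Or.inl (unique s t 1 0 (by rw [← h1]; ring) (by rw [← h2]; ring)).1)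
    · obtain rfl : y = w - u := by rw [← h]; simp
      simp only [Prod.fst_sub, Prod.snd_sub, Int.cast_sub] at h1 h2
      exact Or.inr (Or.inr (unique s t 0 1 (by rw [← h1]; ring) (by rw [← h2]; ring)).2)
  have span : ∀ x : ℤ × ℤ, ∃ i j : ℤ, x.1 = i * (v.1 - u.1) + j * (w.1 - u.1) ∧
      x.2 = i * (v.2 - u.2) + j * (w.2 - u.2) := by
    intro x
    obtain ⟨s, t, h1, h2⟩ : ∃ s t : ℝ, (x.1 : ℝ) = s * (v.1 - u.1) + t * (w.1 - u.1) ∧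
        (x.2 : ℝ) = s * (v.2 - u.2) + t * (w.2 - u.2) := by
      refine ⟨(x.1 * (w.2 - u.2) - x.2 * (w.1 - u.1)) / latticeDet u v w,
        ((v.1 - u.1) * x.2 - (v.2 - u.2) * x.1) / latticeDet u v w, ?_, ?_⟩
      all_goals field_simp; simp only [latticeDet]; push_cast; ring
    have hs0 := Int.fract_nonneg s
    have ht0 := Int.fract_nonneg t
    have hs1 := Int.fract_lt_one s
    have ht1 := Int.fract_lt_one t
    have hs := Int.floor_add_fract s
    have ht := Int.floor_add_fract t
    rcases le_or_gt (Int.fract s + Int.fract t) 1 with hle | hgt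
    · have := vertex (x.1 - ⌊s⌋ * (v.1 - u.1) - ⌊t⌋ * (w.1 - u.1),
        x.2 - ⌊s⌋ * (v.2 - u.2) - ⌊t⌋ * (w.2 - u.2)) _ _ hs0 ht0 hle
        (by push_cast; rw [h1]; linear_combination -(v.1 - u.1 : ℝ) * hs - (w.1 - u.1 : ℝ) * ht)
        (by push_cast; rw [h2]; linear_combination -(v.2 - u.2 : ℝ) * hs - (w.2 - u.2 : ℝ) * ht)
      rcases this with ⟨hs', ht'⟩ | h | h
      · refine ⟨⌊s⌋, ⌊t⌋, ?_, ?_⟩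
        · rw [hs', add_zero] at hs; rw [ht', add_zero] at ht
          rw [← hs, ← ht] at h1; exact_mod_cast h1
        · rw [hs', add_zero] at hs; rw [ht', add_zero] at ht
          rw [← hs, ← ht] at h2; exact_mod_cast h2
      · linarith
      · linarith
    · have := vertex ((⌊s⌋ + 1) * (v.1 - u.1) + (⌊t⌋ + 1) * (w.1 - u.1) - x.1,
        (⌊s⌋ + 1) * (v.2 - u.2) + (⌊t⌋ + 1) * (w.2 - u.2) - x.2)
        (1 - Int.fract s) (1 - Int.fract t) (by linarith) (by linarith) (by linarith)
        (by push_cast; rw [h1]; linear_combination (v.1 - u.1 : ℝ) * hs + (w.1 - u.1 : ℝ) * ht)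
        (by push_cast; rw [h2]; linear_combination (v.2 - u.2 : ℝ) * hs + (w.2 - u.2 : ℝ) * ht)
      rcases this with ⟨h, -⟩ | h | h <;> linarith
  obtain ⟨i, j, h1, h2⟩ := span (1, 0)
  obtain ⟨i', j', h3, h4⟩ := span (0, 1)
  refine Int.isUnit_iff.1 (IsUnit.of_mul_eq_one (i * j' - j * i') ?_)
  simp only [latticeDet]
  linear_combination -(i' * (v.2 - u.2) + j' * (w.2 - u.2)) * h1 - h4 +
    (i' * (v.1 - u.1) + j' * (w.1 - u.1)) * h2

/-- Uniqueness of expansions in base `C` with small digits. -/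
theorem digits_eq_zero {ι : Type*} {C : ℤ} {k : ι → ℕ} {f : ι → ℤ} (s : Finset ι)
    (hk : Set.InjOn k s) (hf : ∀ i ∈ s, |f i| < C) (h : ∑ i ∈ s, f i * C ^ k i = 0) :
    ∀ i ∈ s, f i = 0 := by
  classical
  induction s using Finset.strongInduction with
  | H s ih =>
    rcases s.eq_empty_or_nonempty with rfl | hne
    · simp
    obtain ⟨j, hj, hmin⟩ := s.exists_min_image k hne
    have hC : 0 < C := (abs_nonneg _).trans_lt (hf j hj)
    have hfj : f j = 0 := by
      have hdvd : C ^ (k j + 1) ∣ ∑ i ∈ s.erase j, f i * C ^ k i := by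
        refine Finset.dvd_sum fun i hi => Dvd.dvd.mul_left (pow_dvd_pow _ ?_) _
        have hne := Finset.ne_of_mem_erase hi
        have his := Finset.mem_of_mem_erase hi
        exact lt_of_le_of_ne (hmin i his) fun he => hne (hk his hj he.symm)
      rw [← Finset.add_sum_erase s _ hj] at h
      have h' : C ^ (k j + 1) ∣ f j * C ^ k j := by
        rw [eq_neg_of_add_eq_zero_left h]; exact hdvd.neg_right
      rw [pow_succ', mul_dvd_mul_iff_right (pow_pos hC _).ne'] at h'
      exact Int.eq_zero_of_abs_lt_dvd h' (hf j hj)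
    intro i hi
    rcases eq_or_ne i j with rfl | hij
    · exact hfj
    · refine ih (s.erase j) (Finset.erase_ssubset hj)
        (hk.mono (by simp)) (fun i hi => hf i (Finset.mem_of_mem_erase hi)) ?_ i
        (Finset.mem_erase.2 ⟨hij, hi⟩)
      rw [← Finset.add_sum_erase s _ hj, hfj, zero_mul, zero_add] at h
      exact h

theorem IsGenericConvex.scale_add_affine {A : Finset (ℤ × ℤ)} {P H : ℤ × ℤ → ℝ}
    (h : IsGenericConvex A P) {c : ℝ} (hc : 0 < c) (M : ℝ × ℝ × ℝ)
    (hH : ∀ p, H p = c * P p + affEval M (latticeEmb p)) : IsGenericConvex A H := by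
  constructor
  · intro u hu v hv w hw q hq x y z hx hy hz hxyz e1 e2
    have h1 := h.convex u hu v hv w hw q hq x y z hx hy hz hxyz e1 e2
    have h2 := affEval_comb (u := latticeEmb u) (v := latticeEmb v) (w := latticeEmb w)
      (p := latticeEmb q) M hxyz e1 e2
    have h3 := mul_le_mul_of_nonneg_left h1 hc.le
    rw [hH, hH, hH, hH, h2]
    linarith
  · intro L t ht q hq hqe
    set L' : ℝ × ℝ × ℝ := ((L.1 - M.1) / c, (L.2.1 - M.2.1) / c, (L.2.2 - M.2.2) / c) with hL'
    have hval : ∀ p, affEval L (latticeEmb p) = H p → affEval L' (latticeEmb p) = P p := by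
      intro p hp
      rw [hH] at hp
      have : c * affEval L' (latticeEmb p) = c * P p := by
        have hsub : c * affEval L' (latticeEmb p) =
            affEval L (latticeEmb p) - affEval M (latticeEmb p) := by
          rw [hL']
          simp only [affEval]
          field_simp
          ring
        rw [hsub, hp, add_sub_cancel_right]
      exact mul_left_cancel₀ hc.ne' this
    exact h.generic L' t ⟨ht.mem₁, ht.mem₂, ht.mem₃, ht.nondeg, hval _ ht.eq₁, hval _ ht.eq₂,
      hval _ ht.eq₃⟩ q hq (hval q hqe)

/-- Exponential heights on the lattice points of the rectangle `[0, m] × [0, n]`. -/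
def expHeight (n m : ℕ) (p : ℤ × ℤ) : ℤ :=
  (2 * m * n + 1) ^ (p.1 + (m + 1) * p.2).toNat

theorem isGenericConvex_expHeight {n m : ℕ} {A : Finset (ℤ × ℤ)}
    (hA : ∀ a ∈ A, 0 ≤ a.1 ∧ a.1 ≤ m ∧ 0 ≤ a.2 ∧ a.2 ≤ n) :
    IsGenericConvex A (fun p => (expHeight n m p : ℝ)) := by
  have hk : ∀ a ∈ A, (((a.1 + (m + 1) * a.2).toNat : ℕ) : ℤ) = a.1 + (m + 1) * a.2 := by
    intro a ha
    obtain ⟨h1, h2, h3, h4⟩ := hA a ha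
    exact Int.toNat_of_nonneg (by positivity)
  set C : ℝ := 2 * m * n + 1 with hC
  have hC0 : 0 < C := by positivity
  have hexp : ∀ a ∈ A, (expHeight n m a : ℝ) =
      Real.exp (Real.log C * (a.1 + (m + 1) * a.2)) := by
    intro a ha
    have : ((a.1 + (m + 1) * a.2 : ℝ)) = ((a.1 + (m + 1) * a.2).toNat : ℕ) := by
      have := hk a ha
      exact_mod_cast this.symm
    rw [this, mul_comm, Real.exp_nat_mul, Real.exp_log hC0, expHeight]
    push_cast
    rfl
  constructor
  · intro u hu v hv w hw q hq x y z hx hy hz hxyz e1 e2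
    set κ := Real.log C
    set k : ℤ × ℤ → ℝ := fun a => a.1 + (m + 1) * a.2 with hkdef
    have tangent : ∀ a ∈ A,
        expHeight n m q * (1 + κ * (k a - k q)) ≤ (expHeight n m a : ℝ) := by
      intro a ha
      rw [hexp a ha, hexp q hq]
      have : κ * (a.1 + (m + 1) * a.2) = κ * (q.1 + (m + 1) * q.2) + κ * (k a - k q) := by
        simp only [hkdef]; ring
      rw [this, Real.exp_add]
      refine mul_le_mul_of_nonneg_left ?_ (Real.exp_pos _).le
      linarith [Real.add_one_le_exp (κ * (k a - k q))]
    have t1 := mul_le_mul_of_nonneg_left (tangent u hu) hx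
    have t2 := mul_le_mul_of_nonneg_left (tangent v hv) hy
    have t3 := mul_le_mul_of_nonneg_left (tangent w hw) hz
    refine le_trans (le_of_eq ?_) (add_le_add (add_le_add t1 t2) t3)
    simp only [hkdef]
    rw [← e1, ← e2]
    linear_combination -(expHeight n m q : ℝ) * (1 - κ * (x * u.1 + y * v.1 + z * w.1 +
      (m + 1) * (x * u.2 + y * v.2 + z * w.2))) * hxyz
  · intro L t ht q hq hqe
    by_contra! hne
    obtain ⟨a, b, c, habc, e1, e2⟩ := exists_barycentric ht.nondeg (latticeEmb q)
    have hv := affEval_comb L habc e1 e2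
    obtain ⟨o1, o2, o3⟩ := orient_eq_of_comb habc e1 e2
    rw [ht.eq₁, ht.eq₂, ht.eq₃, hqe] at hv
    have hn := ht.nondeg
    rw [orient_latticeEmb] at hn
    have ne12 : t.1 ≠ t.2.1 := fun h => hn (by rw [h]; simp [latticeDet])
    have ne13 : t.1 ≠ t.2.2 := fun h => hn (by rw [h]; simp [latticeDet])
    have ne23 : t.2.1 ≠ t.2.2 := fun h => hn (by rw [h]; simp [latticeDet]; ring)
    simp only [orient_latticeEmb] at o1 o2 o3
    have hrel : latticeDet q t.2.1 t.2.2 * expHeight n m t.1 +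
        latticeDet t.1 q t.2.2 * expHeight n m t.2.1 +
        latticeDet t.1 t.2.1 q * expHeight n m t.2.2 +
        -latticeDet t.1 t.2.1 t.2.2 * expHeight n m q = 0 := by
      have : (latticeDet q t.2.1 t.2.2 * expHeight n m t.1 +
        latticeDet t.1 q t.2.2 * expHeight n m t.2.1 +
        latticeDet t.1 t.2.1 q * expHeight n m t.2.2 +
        -latticeDet t.1 t.2.1 t.2.2 * expHeight n m q : ℝ) = 0 := by
        rw [o1, o2, o3, hv]; ring
      exact_mod_cast this
    have hbound : ∀ u ∈ A, ∀ v ∈ A, ∀ w ∈ A, |latticeDet u v w| < 2 * m * n + 1 := by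
      intro u hu v hv w hw
      obtain ⟨u1, u2, u3, u4⟩ := hA u hu
      obtain ⟨v1, v2, v3, v4⟩ := hA v hv
      obtain ⟨w1, w2, w3, w4⟩ := hA w hw
      have a1 : |v.1 - u.1| ≤ m := abs_le.2 ⟨by linarith, by linarith⟩
      have a2 : |w.2 - u.2| ≤ n := abs_le.2 ⟨by linarith, by linarith⟩
      have a3 : |v.2 - u.2| ≤ n := abs_le.2 ⟨by linarith, by linarith⟩
      have a4 : |w.1 - u.1| ≤ m := abs_le.2 ⟨by linarith, by linarith⟩
      have b1 := mul_le_mul a1 a2 (abs_nonneg _) (by positivity)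
      have b2 := mul_le_mul a3 a4 (abs_nonneg _) (by positivity)
      rw [← abs_mul] at b1 b2
      have := abs_sub ((v.1 - u.1) * (w.2 - u.2)) ((v.2 - u.2) * (w.1 - u.1))
      unfold latticeDet
      linarith
    have hinj : ∀ a ∈ A, ∀ b ∈ A,
        (a.1 + (m + 1) * a.2).toNat = (b.1 + (m + 1) * b.2).toNat → a = b := by
      intro a ha b hb hab
      have h := congrArg (Nat.cast : ℕ → ℤ) hab
      rw [hk a ha, hk b hb] at h
      obtain ⟨a1, a2, a3, a4⟩ := hA a ha
      obtain ⟨b1, b2, b3, b4⟩ := hA b hb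
      have h2 : a.2 = b.2 := by
        by_contra hne
        rcases lt_or_gt_of_ne hne with hlt | hlt <;> nlinarith
      rw [h2] at h
      exact Prod.ext (by linarith) h2
    set pt : Fin 4 → ℤ × ℤ := ![t.1, t.2.1, t.2.2, q] with hpt
    have hptA : ∀ i, pt i ∈ A := by
      intro i; fin_cases i
      exacts [ht.mem₁, ht.mem₂, ht.mem₃, hq]
    have hptinj : Function.Injective pt := by
      obtain ⟨n1, n2, n3⟩ := hne
      intro i j hij
      fin_cases i <;> fin_cases j <;> first
        | rfl
        | exact absurd hij ne12
        | exact absurd hij ne12.symm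
        | exact absurd hij ne13
        | exact absurd hij ne13.symm
        | exact absurd hij ne23
        | exact absurd hij ne23.symm
        | exact absurd hij n1
        | exact absurd hij n1.symm
        | exact absurd hij n2
        | exact absurd hij n2.symm
        | exact absurd hij n3
        | exact absurd hij n3.symm
    have hzero := digits_eq_zero (C := 2 * m * n + 1)
      (k := fun i => ((pt i).1 + (m + 1) * (pt i).2).toNat)
      (f := ![latticeDet q t.2.1 t.2.2, latticeDet t.1 q t.2.2, latticeDet t.1 t.2.1 q,
        -latticeDet t.1 t.2.1 t.2.2]) Finset.univ
      (fun i _ j _ hij => hptinj (hinj _ (hptA i) _ (hptA j) hij))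
      (by
        intro i _; fin_cases i
        · exact hbound _ hq _ ht.mem₂ _ ht.mem₃
        · exact hbound _ ht.mem₁ _ hq _ ht.mem₃
        · exact hbound _ ht.mem₁ _ ht.mem₂ _ hq
        · simpa using hbound _ ht.mem₁ _ ht.mem₂ _ ht.mem₃)
      (by simpa [Fin.sum_univ_four, hpt, expHeight] using hrel)
    exact hn (by simpa using hzero 3 (Finset.mem_univ _))

theorem IsLowerFacet.rotate {A : Finset (ℤ × ℤ)} {H : ℤ × ℤ → ℝ} {L : ℝ × ℝ × ℝ} {u v w : ℤ × ℤ}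
    (h : IsLowerFacet A H L (u, v, w)) : IsLowerFacet A H L (v, w, u) where
  mem₁ := h.mem₂
  mem₂ := h.mem₃
  mem₃ := h.mem₁
  nondeg := by
    have := h.nondeg
    rw [orient_latticeEmb] at this ⊢
    convert this using 2
    simp only [latticeDet]; ring
  eq₁ := h.eq₂
  eq₂ := h.eq₃
  eq₃ := h.eq₁
  le := h.le

theorem IsLowerFacet.swap {A : Finset (ℤ × ℤ)} {H : ℤ × ℤ → ℝ} {L : ℝ × ℝ × ℝ} {u v w : ℤ × ℤ}
    (h : IsLowerFacet A H L (u, v, w)) : IsLowerFacet A H L (v, u, w) where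
  mem₁ := h.mem₂
  mem₂ := h.mem₁
  mem₃ := h.mem₃
  nondeg := by
    have := h.nondeg
    rw [← neg_ne_zero] at this
    convert this using 1
    unfold orient; ring
  eq₁ := h.eq₂
  eq₂ := h.eq₁
  eq₃ := h.eq₃
  le := h.le

theorem IsLowerFacet.exists_third {A : Finset (ℤ × ℤ)} {H : ℤ × ℤ → ℝ} {L : ℝ × ℝ × ℝ}
    {t : (ℤ × ℤ) × (ℤ × ℤ) × (ℤ × ℤ)} (h : IsLowerFacet A H L t) {u v : ℤ × ℤ} (huv : u ≠ v)
    (hu : u = t.1 ∨ u = t.2.1 ∨ u = t.2.2) (hv : v = t.1 ∨ v = t.2.1 ∨ v = t.2.2) :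
    ∃ w, IsLowerFacet A H L (u, v, w) := by
  obtain ⟨a, b, c⟩ := t
  rcases hu with rfl | rfl | rfl <;> rcases hv with rfl | rfl | rfl
  · exact absurd rfl huv
  · exact ⟨_, h⟩
  · exact ⟨_, h.rotate.rotate.swap⟩
  · exact ⟨_, h.swap⟩
  · exact absurd rfl huv
  · exact ⟨_, h.rotate⟩
  · exact ⟨_, h.rotate.rotate⟩
  · exact ⟨_, h.rotate.swap⟩
  · exact absurd rfl huv

/-- The lattice points of the Newton triangle, without the relative interior of the edge
joining `(m, 0)` and `(0, n)`. -/
def newtonPoints (n m : ℕ) : Finset (ℤ × ℤ) :=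
  (Finset.Icc (0 : ℤ) m ×ˢ Finset.Icc (0 : ℤ) n).filter fun p =>
    n * p.1 + m * p.2 < n * m ∨ p = ((m : ℤ), 0) ∨ p = (0, (n : ℤ))

theorem mem_newtonPoints {n m : ℕ} (hn : 0 < n) (hm : 0 < m) {p : ℤ × ℤ} :
    p ∈ newtonPoints n m ↔ (0 ≤ p.1 ∧ 0 ≤ p.2 ∧ (n : ℤ) * p.1 + m * p.2 < n * m) ∨
      p = ((m : ℤ), 0) ∨ p = (0, (n : ℤ)) := by
  simp only [newtonPoints, Finset.mem_filter, Finset.mem_product, Finset.mem_Icc]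
  constructor
  · rintro ⟨⟨⟨h1, h2⟩, h3, h4⟩, h | h⟩
    · exact Or.inl ⟨h1, h3, h⟩
    · exact Or.inr h
  · rintro (⟨h1, h2, h3⟩ | rfl | rfl)
    · have hn' : (0 : ℤ) < n := by exact_mod_cast hn
      have hm' : (0 : ℤ) < m := by exact_mod_cast hm
      refine ⟨⟨⟨h1, ?_⟩, h2, ?_⟩, Or.inl h3⟩ <;> nlinarith
    · simp
    · simp

/-- The integral heights inducing the triangulation of the Newton triangle. -/
def newtonHeight (n m : ℕ) (p : ℤ × ℤ) : ℤ :=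
  n * m * expHeight n m p - n * expHeight n m (m, 0) * p.1 - m * expHeight n m (0, n) * p.2 +
    n * m * (expHeight n m (m, 0) + expHeight n m (0, n)) * (n * m - n * p.1 - m * p.2)

theorem newtonHeight_right (n m : ℕ) : newtonHeight n m (m, 0) = 0 := by
  simp only [newtonHeight]; ring

theorem newtonHeight_left (n m : ℕ) : newtonHeight n m (0, n) = 0 := by
  simp only [newtonHeight]; ring

theorem newtonHeight_nonneg {n m : ℕ} (hn : 0 < n) (hm : 0 < m) {p : ℤ × ℤ}
    (hp : p ∈ newtonPoints n m) : 0 ≤ newtonHeight n m p := by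
  have hpos : ∀ q, 0 < expHeight n m q := fun q => by unfold expHeight; positivity
  have hbox := hp
  simp only [newtonPoints, Finset.mem_filter, Finset.mem_product, Finset.mem_Icc] at hbox
  obtain ⟨⟨⟨h1, h2⟩, h3, h4⟩, -⟩ := hbox
  rcases (mem_newtonPoints hn hm).1 hp with ⟨-, -, h⟩ | rfl | rfl
  · have h0 := hpos p
    have ha := hpos (m, 0)
    have hb := hpos (0, n)
    unfold newtonHeight
    set a := expHeight n m (m, 0)
    set b := expHeight n m (0, n)
    have e0 : 0 ≤ (n : ℤ) * m * expHeight n m p := by positivity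
    have e1 : (n : ℤ) * a * p.1 ≤ n * a * m := by gcongr
    have e2 : (m : ℤ) * b * p.2 ≤ m * b * n := by gcongr
    have e3 : (n : ℤ) * m * (a + b) * 1 ≤ n * m * (a + b) * (n * m - n * p.1 - m * p.2) := by
      gcongr
      linarith
    linarith
  · exact (newtonHeight_right n m).ge
  · exact (newtonHeight_left n m).ge

theorem isGenericConvex_newtonHeight {n m : ℕ} (hn : 0 < n) (hm : 0 < m) :
    IsGenericConvex (newtonPoints n m) (fun p => (newtonHeight n m p : ℝ)) := by
  have h := isGenericConvex_expHeight (n := n) (m := m) (A := newtonPoints n m) (by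
    intro a ha
    simp only [newtonPoints, Finset.mem_filter, Finset.mem_product, Finset.mem_Icc] at ha
    tauto)
  set K : ℝ := n * m * (expHeight n m (m, 0) + expHeight n m (0, n)) with hK
  refine h.scale_add_affine (c := n * m) (by positivity)
    (-(n * expHeight n m (m, 0)) - K * n, -(m * expHeight n m (0, n)) - K * m, K * (n * m)) ?_
  intro p
  simp only [newtonHeight, affEval, latticeEmb, hK]
  push_cast
  ring

/-- The defect of the linear form defining the edge joining `(m, 0)` and `(0, n)`. -/
def edgeGap (n m : ℕ) : ℝ × ℝ × ℝ := (-n, -m, n * m)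

theorem affEval_edgeGap (n m : ℕ) (p : ℝ × ℝ) :
    affEval (edgeGap n m) p = n * m - n * p.1 - m * p.2 := by
  simp only [affEval, edgeGap]; ring

/-- The vertices of the Newton triangle. -/
def newtonVertices (n m : ℕ) : (ℤ × ℤ) × (ℤ × ℤ) × (ℤ × ℤ) :=
  ((0, 0), ((m : ℤ), 0), (0, (n : ℤ)))

theorem mem_newtonTriangle {n m : ℕ} (hn : 0 < n) (hm : 0 < m) {p : ℝ × ℝ} :
    p ∈ latticeTriangle (newtonVertices n m) ↔
      0 ≤ p.1 ∧ 0 ≤ p.2 ∧ 0 ≤ affEval (edgeGap n m) p := by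
  have hn' : (0 : ℝ) < n := by exact_mod_cast hn
  have hm' : (0 : ℝ) < m := by exact_mod_cast hm
  rw [latticeTriangle, mem_convexHull_triple, affEval_edgeGap]
  simp only [newtonVertices, latticeEmb]
  push_cast
  constructor
  · rintro ⟨a, b, c, ha, hb, hc, h, h1, h2⟩
    rw [← h1, ← h2]
    refine ⟨by simp; positivity, by simp; positivity, ?_⟩
    have : 0 ≤ a * (n * m : ℝ) := by positivity
    linear_combination this + n * m * h
  · rintro ⟨h1, h2, h3⟩
    refine ⟨1 - p.1 / m - p.2 / n, p.1 / m, p.2 / n, ?_, by positivity, by positivity, by ring,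
      by field_simp; ring, by field_simp; ring⟩
    have : 1 - p.1 / m - p.2 / n = (n * m - n * p.1 - m * p.2) / (n * m) := by
      field_simp
    rw [this]
    positivity

theorem mem_newtonEdge {n m : ℕ} (hn : 0 < n) (hm : 0 < m) {p : ℝ × ℝ} :
    p ∈ segment ℝ ((m : ℝ), (0 : ℝ)) ((0 : ℝ), (n : ℝ)) ↔
      0 ≤ p.1 ∧ 0 ≤ p.2 ∧ affEval (edgeGap n m) p = 0 := by
  have hn' : (0 : ℝ) < n := by exact_mod_cast hn
  have hm' : (0 : ℝ) < m := by exact_mod_cast hm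
  rw [affEval_edgeGap]
  constructor
  · rintro ⟨a, b, ha, hb, h, rfl⟩
    simp only [Prod.smul_mk, Prod.mk_add_mk, smul_eq_mul, mul_zero, zero_add, add_zero]
    refine ⟨by positivity, by positivity, ?_⟩
    linear_combination -(n * m : ℝ) * h
  · rintro ⟨h1, h2, h3⟩
    refine ⟨p.1 / m, p.2 / n, by positivity, by positivity, ?_, ?_⟩
    · field_simp; linarith
    · ext <;> simp <;> field_simp

theorem latticeEmb_injective : Function.Injective latticeEmb := by
  intro p q h
  simpa [latticeEmb, Prod.ext_iff] using h

theorem latticeEmb_mem_newtonTriangle {n m : ℕ} (hn : 0 < n) (hm : 0 < m) {p : ℤ × ℤ}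
    (hp : p ∈ newtonPoints n m) : latticeEmb p ∈ latticeTriangle (newtonVertices n m) := by
  rw [mem_newtonTriangle hn hm, affEval_edgeGap]
  simp only [latticeEmb]
  rcases (mem_newtonPoints hn hm).1 hp with ⟨h1, h2, h3⟩ | rfl | rfl
  · refine ⟨by exact_mod_cast h1, by exact_mod_cast h2, ?_⟩
    have : ((n : ℝ) * p.1 + m * p.2) < n * m := by exact_mod_cast h3
    linarith
  · simp
  · simp [mul_comm]

theorem mem_newtonPoints_of_edgeGap_ne_zero {n m : ℕ} (hn : 0 < n) (hm : 0 < m) {p : ℤ × ℤ}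
    (hp : latticeEmb p ∈ latticeTriangle (newtonVertices n m))
    (h : affEval (edgeGap n m) (latticeEmb p) ≠ 0) : p ∈ newtonPoints n m := by
  obtain ⟨h1, h2, h3⟩ := (mem_newtonTriangle hn hm).1 hp
  have h4 := lt_of_le_of_ne h3 h.symm
  rw [affEval_edgeGap] at h4
  simp only [latticeEmb] at h1 h2 h4
  refine (mem_newtonPoints hn hm).2 (Or.inl ⟨by exact_mod_cast h1, by exact_mod_cast h2, ?_⟩)
  have : ((n : ℝ) * p.1 + m * p.2) < n * m := by linarith
  exact_mod_cast this

theorem eq_endpoint_of_edgeGap_eq_zero {n m : ℕ} (hn : 0 < n) (hm : 0 < m) {p : ℤ × ℤ}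
    (hp : p ∈ newtonPoints n m) (h : affEval (edgeGap n m) (latticeEmb p) = 0) :
    p = ((m : ℤ), 0) ∨ p = (0, (n : ℤ)) := by
  rcases (mem_newtonPoints hn hm).1 hp with ⟨-, -, h3⟩ | h'
  · rw [affEval_edgeGap] at h
    have : ((n : ℝ) * p.1 + m * p.2) < n * m := by exact_mod_cast h3
    simp only [latticeEmb] at h
    linarith
  · exact h'

theorem affEval_edgeGap_right (n m : ℕ) :
    affEval (edgeGap n m) (latticeEmb ((m : ℤ), 0)) = 0 := by
  rw [affEval_edgeGap]; simp [latticeEmb]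

theorem affEval_edgeGap_left (n m : ℕ) :
    affEval (edgeGap n m) (latticeEmb (0, (n : ℤ))) = 0 := by
  rw [affEval_edgeGap]; simp [latticeEmb]; ring

/-- A facet containing a point of the edge that is not an endpoint has both endpoints of the edge
as vertices. -/
theorem endpoints_of_mem_edge {n m : ℕ} (hn : 0 < n) (hm : 0 < m) {H : ℤ × ℤ → ℝ}
    {L : ℝ × ℝ × ℝ} {t : (ℤ × ℤ) × (ℤ × ℤ) × (ℤ × ℤ)}
    (h : IsLowerFacet (newtonPoints n m) H L t) {p : ℝ × ℝ} (hp : p ∈ latticeTriangle t)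
    (hgap : affEval (edgeGap n m) p = 0) (hpr : p ≠ latticeEmb ((m : ℤ), 0))
    (hpl : p ≠ latticeEmb (0, (n : ℤ))) :
    (((m : ℤ), (0 : ℤ)) = t.1 ∨ ((m : ℤ), (0 : ℤ)) = t.2.1 ∨ ((m : ℤ), (0 : ℤ)) = t.2.2) ∧
      (((0 : ℤ), (n : ℤ)) = t.1 ∨ ((0 : ℤ), (n : ℤ)) = t.2.1 ∨ ((0 : ℤ), (n : ℤ)) = t.2.2) := by
  obtain ⟨a, b, c, ha, hb, hc, habc, e1, e2⟩ := mem_convexHull_triple.1 hp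
  have hcomb := affEval_comb (edgeGap n m) habc e1 e2
  rw [hgap] at hcomb
  have nonneg : ∀ v ∈ newtonPoints n m, 0 ≤ affEval (edgeGap n m) (latticeEmb v) := fun v hv =>
    ((mem_newtonTriangle hn hm).1 (latticeEmb_mem_newtonTriangle hn hm hv)).2.2
  have g1 := mul_nonneg ha (nonneg _ h.mem₁)
  have g2 := mul_nonneg hb (nonneg _ h.mem₂)
  have g3 := mul_nonneg hc (nonneg _ h.mem₃)
  have vertex : ∀ (r : ℝ) (v : ℤ × ℤ), v ∈ newtonPoints n m →
      r * affEval (edgeGap n m) (latticeEmb v) = 0 → r = 0 ∨ v = ((m : ℤ), 0) ∨ v = (0, (n : ℤ)) :=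
    fun r v hv hr => (mul_eq_zero.1 hr).imp_right (eq_endpoint_of_edgeGap_eq_zero hn hm hv)
  have v1 := vertex a _ h.mem₁ (by linarith)
  have v2 := vertex b _ h.mem₂ (by linarith)
  have v3 := vertex c _ h.mem₃ (by linarith)
  have single : ∀ E : ℤ × ℤ, (a = 0 ∨ t.1 = E) → (b = 0 ∨ t.2.1 = E) → (c = 0 ∨ t.2.2 = E) →
      p = latticeEmb E := by
    intro E h1 h2 h3
    have s : ∀ (r : ℝ) (v : ℤ × ℤ), (r = 0 ∨ v = E) →
        r * (latticeEmb v).1 = r * (latticeEmb E).1 ∧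
        r * (latticeEmb v).2 = r * (latticeEmb E).2 := by
      rintro r v (rfl | rfl) <;> simp
    obtain ⟨a1, a2⟩ := s _ _ h1
    obtain ⟨b1, b2⟩ := s _ _ h2
    obtain ⟨c1, c2⟩ := s _ _ h3
    ext
    · rw [← e1, a1, b1, c1, ← add_mul, ← add_mul, habc, one_mul]
    · rw [← e2, a2, b2, c2, ← add_mul, ← add_mul, habc, one_mul]
  constructor
  · by_contra! hne
    obtain ⟨n1, n2, n3⟩ := hne
    exact hpl (single _ (v1.imp_right fun h => h.resolve_left n1.symm)
      (v2.imp_right fun h => h.resolve_left n2.symm)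
      (v3.imp_right fun h => h.resolve_left n3.symm))
  · by_contra! hne
    obtain ⟨n1, n2, n3⟩ := hne
    exact hpr (single _ (v1.imp_right fun h => h.resolve_right n1.symm)
      (v2.imp_right fun h => h.resolve_right n2.symm)
      (v3.imp_right fun h => h.resolve_right n3.symm))

theorem isLift_newtonVertices {n m : ℕ} (hn : 0 < n) (hm : 0 < m) (H : ℤ × ℤ → ℝ) :
    IsLift (newtonPoints n m) H (facetPlane H (newtonVertices n m)) (newtonVertices n m) := by
  have hn' : (0 : ℤ) < n := by exact_mod_cast hn
  have hm' : (0 : ℤ) < m := by exact_mod_cast hm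
  refine isLift_facetPlane ?_ ?_ ?_ ?_
  · exact (mem_newtonPoints hn hm).2 (Or.inl (by simp [newtonVertices]; positivity))
  · exact (mem_newtonPoints hn hm).2 (Or.inr (Or.inl rfl))
  · exact (mem_newtonPoints hn hm).2 (Or.inr (Or.inr rfl))
  · rw [orient_latticeEmb]
    simp [newtonVertices, latticeDet, hn.ne', hm.ne']

theorem exists_edge_facet {n m : ℕ} (hn : 0 < n) (hm : 0 < m) (H : ℤ × ℤ → ℝ) :
    ∃ L w, IsLowerFacet (newtonPoints n m) H L (((m : ℤ), 0), (0, (n : ℤ)), w) := by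
  have hn' : (0 : ℝ) < n := by exact_mod_cast hn
  have hm' : (0 : ℝ) < m := by exact_mod_cast hm
  have hgap : affEval (edgeGap n m) ((m : ℝ) / 2, (n : ℝ) / 2) = 0 := by
    rw [affEval_edgeGap]; ring
  obtain ⟨L, t, hf, ht⟩ := exists_isLowerFacet (isLift_newtonVertices hn hm H)
    (p := ((m : ℝ) / 2, (n : ℝ) / 2))
    ((mem_newtonTriangle hn hm).2 ⟨by positivity, by positivity, hgap.ge⟩)
  obtain ⟨hr, hl⟩ := endpoints_of_mem_edge hn hm hf ht hgap
    (by simp [latticeEmb, hn.ne']) (by simp [latticeEmb, hm.ne'])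
  obtain ⟨w, hw⟩ := hf.exists_third (by simp [hm.ne']) hr hl
  exact ⟨L, w, hw⟩

theorem edgeGap_third_pos {n m : ℕ} (hn : 0 < n) (hm : 0 < m) {H : ℤ × ℤ → ℝ}
    {L : ℝ × ℝ × ℝ} {w : ℤ × ℤ}
    (h : IsLowerFacet (newtonPoints n m) H L (((m : ℤ), 0), (0, (n : ℤ)), w)) :
    0 < affEval (edgeGap n m) (latticeEmb w) := by
  refine lt_of_le_of_ne
    ((mem_newtonTriangle hn hm).1 (latticeEmb_mem_newtonTriangle hn hm h.mem₃)).2.2 fun h0 => ?_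
  have hd := h.nondeg
  rw [orient_latticeEmb] at hd
  rcases eq_endpoint_of_edgeGap_eq_zero hn hm h.mem₃ h0.symm with rfl | rfl
  · exact hd (by simp [latticeDet])
  · exact hd (by simp [latticeDet]; ring)

/-- The affine function of a facet containing the whole edge is unique. -/
theorem edge_facet_unique {n m : ℕ} (hn : 0 < n) (hm : 0 < m) {H : ℤ × ℤ → ℝ}
    {L L' : ℝ × ℝ × ℝ} {w w' : ℤ × ℤ}
    (h : IsLowerFacet (newtonPoints n m) H L (((m : ℤ), 0), (0, (n : ℤ)), w))
    (h' : IsLowerFacet (newtonPoints n m) H L' (((m : ℤ), 0), (0, (n : ℤ)), w')) : L' = L := by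
  have hw := edgeGap_third_pos hn hm h
  have hw' := edgeGap_third_pos hn hm h'
  obtain ⟨a, b, c, habc, e1, e2⟩ := exists_barycentric h.nondeg (latticeEmb w')
  have hgap := affEval_comb (edgeGap n m) habc e1 e2
  have hL := affEval_comb L habc e1 e2
  have hL' := affEval_comb L' habc e1 e2
  have e1 := h.eq₁
  have e2 := h.eq₂
  have e3 := h.eq₃
  have f1 := h'.eq₁
  have f2 := h'.eq₂
  have f3 := h'.eq₃
  have l1 := h.le _ h'.mem₃
  have l2 := h'.le _ h.mem₃
  simp only at *
  rw [affEval_edgeGap_right, affEval_edgeGap_left, mul_zero, mul_zero, zero_add, zero_add] at hgap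
  have hc : 0 < c := by
    rw [hgap] at hw'
    exact pos_of_mul_pos_left hw' hw.le
  refine h.toIsLift.ext_of_eq f1 f2 (le_antisymm l2 ?_)
  refine le_of_mul_le_mul_left ?_ hc
  rw [e1, e2] at hL
  rw [f1, f2] at hL'
  simp only
  rw [← e3]
  linarith

/-- The facet adjacent to the edge has lattice height one over it. -/
theorem edge_facet_det {m' n' e : ℕ} (he : 0 < e) (hn : 0 < n') (hm : 0 < m')
    (hcop : Nat.Coprime n' m') {H : ℤ × ℤ → ℝ}
    (hg : IsGenericConvex (newtonPoints (n' * e) (m' * e)) H) {L : ℝ × ℝ × ℝ} {w : ℤ × ℤ}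
    (h : IsLowerFacet (newtonPoints (n' * e) (m' * e)) H L
      (((m' * e : ℕ), 0), (0, ((n' * e : ℕ) : ℤ)), w)) :
    latticeDet ((m' * e : ℕ), 0) (m' * e - m', n') w = 1 ∨
      latticeDet ((m' * e : ℕ), 0) (m' * e - m', n') w = -1 := by
  have hN : 0 < n' * e := by positivity
  have hM : 0 < m' * e := by positivity
  have he' : (0 : ℝ) < e := by exact_mod_cast he
  have he1 : (1 : ℝ) ≤ e := by exact_mod_cast he
  have hw := edgeGap_third_pos hN hM h
  apply latticeDet_eq_of_empty
  · intro h0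
    have hd := h.nondeg
    rw [orient_latticeEmb] at hd
    apply hd
    have : latticeDet ((m' * e : ℕ), 0) (0, ((n' * e : ℕ) : ℤ)) w =
        e * latticeDet ((m' * e : ℕ), 0) (m' * e - m', n') w := by
      simp only [latticeDet]; push_cast; ring
    simp only
    rw [this, h0]
    simp
  · intro x hx
    obtain ⟨a, b, c, ha, hb, hc, habc, e1, e2⟩ := mem_convexHull_triple.1 hx
    have hgap := affEval_comb (edgeGap (n' * e) (m' * e)) habc e1 e2
    have hmid : affEval (edgeGap (n' * e) (m' * e)) (latticeEmb (m' * e - m', n')) = 0 := by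
      rw [affEval_edgeGap]; simp only [latticeEmb]; push_cast; ring
    rw [affEval_edgeGap_right, hmid, mul_zero, mul_zero, zero_add, zero_add] at hgap
    by_cases hx0 : affEval (edgeGap (n' * e) (m' * e)) (latticeEmb x) = 0
    · rw [hx0] at hgap
      have hc0 : c = 0 := (mul_eq_zero.1 hgap.symm).resolve_right hw.ne'
      rw [hc0, add_zero] at habc
      simp only [latticeEmb, hc0] at e1 e2
      push_cast at e1 e2
      have hline : (n' : ℤ) * (x.1 - m' * e) = -(m' * x.2) := by
        have : (n' : ℝ) * (x.1 - m' * e) = -(m' * x.2) := by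
          rw [← e1, ← e2]
          linear_combination (n' * m' * e : ℝ) * habc
        exact_mod_cast this
      have hdvd : (n' : ℤ) ∣ x.2 := by
        exact (Nat.isCoprime_iff_coprime.2 hcop).dvd_of_dvd_mul_left
          (dvd_neg.1 (hline ▸ dvd_mul_right _ _))
      obtain ⟨j, hj⟩ := hdvd
      have hn0 : (n' : ℝ) ≠ 0 := by positivity
      have hbj : b = j := by
        have : (n' : ℝ) * b = n' * j := by
          have hj' : (x.2 : ℝ) = n' * j := by exact_mod_cast hj
          rw [← hj', ← e2]; ring
        exact mul_left_cancel₀ hn0 this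
      have hj0 : 0 ≤ j := by rw [hbj] at hb; exact_mod_cast hb
      have hj1 : j ≤ 1 := by
        have : b ≤ 1 := by linarith
        rw [hbj] at this; exact_mod_cast this
      have hx1 : x.1 = m' * e - m' * j := by
        have : (x.1 : ℝ) = m' * e - m' * j := by
          rw [← e1, ← hbj]
          linear_combination (m' * e : ℝ) * habc
        exact_mod_cast this
      obtain rfl | rfl : j = 0 ∨ j = 1 := by lia
      · left
        ext
        · rw [hx1]; push_cast; ring
        · rw [hj]; simp
      · right; left
        ext
        · rw [hx1]; ring
        · rw [hj]; simp
    · have hxt : latticeEmb x ∈ latticeTriangle (((m' * e : ℕ), 0), (0, ((n' * e : ℕ) : ℤ)), w) := by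
        refine mem_convexHull_triple.2 ⟨a + b * (1 - 1 / e), b / e, c, ?_, by positivity, hc, ?_,
          ?_, ?_⟩
        · have : 1 / (e : ℝ) ≤ 1 := by rw [div_le_one he']; exact he1
          have := mul_nonneg hb (sub_nonneg.2 this)
          linarith
        · linear_combination habc
        · rw [← e1]; simp only [latticeEmb]; push_cast; field_simp; ring
        · rw [← e2]; simp only [latticeEmb]; push_cast; field_simp; ring
      have hxΔ : latticeEmb x ∈ latticeTriangle (newtonVertices (n' * e) (m' * e)) := by
        refine convexHull_min ?_ (convex_latticeTriangle _) hxt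
        rintro _ (rfl | rfl | rfl)
        exacts [latticeEmb_mem_newtonTriangle hN hM h.mem₁, latticeEmb_mem_newtonTriangle hN hM h.mem₂,
          latticeEmb_mem_newtonTriangle hN hM h.mem₃]
      have hxA := mem_newtonPoints_of_edgeGap_ne_zero hN hM hxΔ hx0
      rcases h.eq_vertex_of_mem hg hxA hxt with rfl | rfl | rfl
      · exact absurd (affEval_edgeGap_right _ _) hx0
      · exact absurd (affEval_edgeGap_left _ _) hx0
      · exact Or.inr (Or.inr rfl)

/-- Lemma 6.1: on the Newton diagram `Δ` with vertices (0,0), (m,0), (0,n) and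
compact edge `Γ = [(m,0),(0,n)]` of integral length `e = gcd(n,m)` there is a convex piecewise
affine function `ω : Δ → ℝ_{≥0}`, integer valued on `Δ ∩ ℤ²` and vanishing on `Γ ∩ ℤ²`,
inducing a triangulation `T, T₁, …, T_N` of `Δ` (the triangles cover `Δ`, have pairwise
disjoint interiors, have vertices in `Δ ∩ ℤ²`, `ω` is affine on each of them and they are
exactly the maximal closed convex subsets of `Δ` on which `ω` is affine) such that: every
lattice point of `Δ \ Γ` is a vertex of a triangle of the family; `T` is the unique triangle
of the family having `Γ` as an edge and `T` is the image of `conv{(0,0),(e,0),(0,1)}` under a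
unimodular integral affine map; and every other triangle `Tᵢ` is primitive. -/
theorem exists_convex_triangulation_of_newton_diagram
    (n m : ℕ) (hn : 0 < n) (hm : 0 < m) (e : ℕ) (he : e = Nat.gcd n m)
    (Γ : Set (ℝ × ℝ)) (hΓ : Γ = segment ℝ ((m : ℝ), (0 : ℝ)) ((0 : ℝ), (n : ℝ)))
    (Δ : Set (ℝ × ℝ))
    (hΔ : Δ = convexHull ℝ {((0 : ℝ), (0 : ℝ)), ((m : ℝ), (0 : ℝ)), ((0 : ℝ), (n : ℝ))}) :
    ∃ (ω : ℝ × ℝ → ℝ) (N : ℕ) (V : Fin (N + 1) → (ℤ × ℤ) × (ℤ × ℤ) × (ℤ × ℤ)),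
      -- ω is convex on Δ, nonnegative, integer valued on Δ ∩ ℤ² and vanishes on Γ ∩ ℤ²
      ConvexOn ℝ Δ ω ∧
      (∀ p ∈ Δ, 0 ≤ ω p) ∧
      (∀ p : ℤ × ℤ, latticeEmb p ∈ Δ → ∃ k : ℤ, ω (latticeEmb p) = (k : ℝ)) ∧
      (∀ p : ℤ × ℤ, latticeEmb p ∈ Γ → ω (latticeEmb p) = 0) ∧
      -- the triangles have their (integral) vertices in Δ and are nondegenerate
      (∀ i, latticeEmb (V i).1 ∈ Δ ∧ latticeEmb (V i).2.1 ∈ Δ ∧ latticeEmb (V i).2.2 ∈ Δ) ∧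
      (∀ i, AffineIndependent ℝ ![latticeEmb (V i).1, latticeEmb (V i).2.1, latticeEmb (V i).2.2]) ∧
      -- they cover Δ and have pairwise disjoint interiors
      (⋃ i, latticeTriangle (V i)) = Δ ∧
      (∀ i j, i ≠ j → interior (latticeTriangle (V i)) ∩ interior (latticeTriangle (V j)) = ∅) ∧
      -- ω is affine on each triangle, and the triangles are exactly the maximal closed
      -- convex subsets of Δ on which ω is affine
      (∀ i, AffineOnSet ω (latticeTriangle (V i))) ∧
      (∀ A : Set (ℝ × ℝ),
        (IsClosed A ∧ Convex ℝ A ∧ A ⊆ Δ ∧ AffineOnSet ω A ∧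
          (∀ B : Set (ℝ × ℝ), IsClosed B → Convex ℝ B → B ⊆ Δ → AffineOnSet ω B →
            A ⊆ B → B = A)) ↔ (∃ i, A = latticeTriangle (V i))) ∧
      -- every lattice point of Δ \ Γ is a vertex of one of the triangles
      (∀ p : ℤ × ℤ, latticeEmb p ∈ Δ → latticeEmb p ∉ Γ →
        ∃ i, p = (V i).1 ∨ p = (V i).2.1 ∨ p = (V i).2.2) ∧
      -- T := the triangle of index 0 contains Γ as an edge …
      (V 0).1 = ((m : ℤ), (0 : ℤ)) ∧ (V 0).2.1 = ((0 : ℤ), (n : ℤ)) ∧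
      segment ℝ (latticeEmb (V 0).1) (latticeEmb (V 0).2.1) = Γ ∧
      -- … and is the unique triangle of the family having Γ as an edge
      (∀ i : Fin (N + 1), i ≠ 0 →
        ¬∃ u v : ℤ × ℤ,
          (u = (V i).1 ∨ u = (V i).2.1 ∨ u = (V i).2.2) ∧
          (v = (V i).1 ∨ v = (V i).2.1 ∨ v = (V i).2.2) ∧
          segment ℝ (latticeEmb u) (latticeEmb v) = Γ) ∧
      -- T is the image of conv{(0,0),(e,0),(0,1)} under a unimodular integral affine map
      (∃ (M : Matrix (Fin 2) (Fin 2) ℤ) (w : ℤ × ℤ),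
        (M.det = 1 ∨ M.det = -1) ∧
        latticeTriangle (V 0) =
          (fun v : ℝ × ℝ =>
            (((M 0 0 : ℝ) * v.1 + (M 0 1 : ℝ) * v.2 + (w.1 : ℝ)),
             ((M 1 0 : ℝ) * v.1 + (M 1 1 : ℝ) * v.2 + (w.2 : ℝ)))) ''
            convexHull ℝ {((0 : ℝ), (0 : ℝ)), ((e : ℝ), (0 : ℝ)), ((0 : ℝ), (1 : ℝ))}) ∧
      -- every other triangle of the family is primitive (has area 1/2)
      (∀ i : Fin (N + 1), i ≠ 0 →
        ((V i).2.1.1 - (V i).1.1) * ((V i).2.2.2 - (V i).1.2) -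
          ((V i).2.1.2 - (V i).1.2) * ((V i).2.2.1 - (V i).1.1) = 1 ∨
        ((V i).2.1.1 - (V i).1.1) * ((V i).2.2.2 - (V i).1.2) -
          ((V i).2.1.2 - (V i).1.2) * ((V i).2.2.1 - (V i).1.1) = -1) := by
  obtain ⟨n', m', hcop, hnn, hmm⟩ := Nat.exists_coprime n m
  rw [← he] at hnn hmm
  have he0 : 0 < e := he ▸ Nat.gcd_pos_of_pos_left _ hn
  have hn' : 0 < n' := Nat.pos_of_ne_zero (by rintro rfl; simp at hnn; lia)
  have hm' : 0 < m' := Nat.pos_of_ne_zero (by rintro rfl; simp at hmm; lia)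
  have hΔ' : Δ = latticeTriangle (newtonVertices n m) := by
    rw [hΔ]; simp [latticeTriangle, newtonVertices, latticeEmb]
  have hΓ' : segment ℝ (latticeEmb ((m : ℤ), 0)) (latticeEmb (0, (n : ℤ))) = Γ := by
    rw [hΓ]; simp [latticeEmb]
  clear hΔ
  subst hΔ'
  set H : ℤ × ℤ → ℝ := fun p => (newtonHeight n m p : ℝ) with hH
  have hg : IsGenericConvex (newtonPoints n m) H := isGenericConvex_newtonHeight hn hm
  obtain ⟨LT, w, hT⟩ := exists_edge_facet hn hm H
  obtain ⟨ω, N, V, L, hV0, hL0, hinj, hV, hω, hconv, hcover, hdisj, hmax, hmax'⟩ :=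
    exists_regular_triangulation hg (isLift_newtonVertices hn hm H)
      (fun _ ha => latticeEmb_mem_newtonTriangle hn hm ha) hT
  have hVΔ : ∀ i, latticeTriangle (V i) ⊆ latticeTriangle (newtonVertices n m) := fun i =>
    hcover ▸ Set.subset_iUnion (fun i => latticeTriangle (V i)) i
  have hmemΓ : ∀ p, p ∈ Γ ↔ 0 ≤ p.1 ∧ 0 ≤ p.2 ∧ affEval (edgeGap n m) p = 0 := by
    intro p
    rw [hΓ]; exact mem_newtonEdge hn hm
  have hωΓ : ∀ p ∈ Γ, ω p = 0 := by
    intro p hp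
    rw [hΓ] at hp
    obtain ⟨a, b, ha, hb, hab, rfl⟩ := hp
    have hmem : a • ((m : ℝ), (0 : ℝ)) + b • ((0 : ℝ), (n : ℝ)) ∈ latticeTriangle (V 0) := by
      rw [hV0]
      refine mem_convexHull_triple.2 ⟨a, b, 0, ha, hb, le_rfl, by simpa using hab, ?_, ?_⟩ <;>
        simp [latticeEmb]
    rw [hω 0 _ hmem, hL0, affEval_comb LT (u := latticeEmb ((m : ℤ), 0))
      (v := latticeEmb (0, (n : ℤ))) (w := 0) (a := a) (b := b) (c := 0) (by simpa using hab)
      (by simp [latticeEmb]) (by simp [latticeEmb])]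
    have e1 := hT.eq₁
    have e2 := hT.eq₂
    simp only [hH, newtonHeight_left, newtonHeight_right] at e1 e2
    rw [e1, e2]
    simp
  have hvertex : ∀ p : ℤ × ℤ, latticeEmb p ∈ latticeTriangle (newtonVertices n m) →
      latticeEmb p ∉ Γ → ∃ i, p = (V i).1 ∨ p = (V i).2.1 ∨ p = (V i).2.2 := by
    intro p hp hpΓ
    have hA : p ∈ newtonPoints n m := mem_newtonPoints_of_edgeGap_ne_zero hn hm hp fun h => by
      have hp' := (mem_newtonTriangle hn hm).1 hp
      exact hpΓ ((hmemΓ _).2 ⟨hp'.1, hp'.2.1, h⟩)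
    obtain ⟨i, hi⟩ := Set.mem_iUnion.1 (hcover ▸ hp)
    exact ⟨i, (hV i).eq_vertex_of_mem hg hA hi⟩
  have hωvertex : ∀ i p, (p = (V i).1 ∨ p = (V i).2.1 ∨ p = (V i).2.2) →
      ω (latticeEmb p) = H p := by
    intro i p hp
    rw [hω i _ (latticeEmb_mem_of_eq hp)]
    rcases hp with rfl | rfl | rfl
    exacts [(hV i).eq₁, (hV i).eq₂, (hV i).eq₃]
  have hne : ((m : ℤ), (0 : ℤ)) ≠ (0, (n : ℤ)) := by simp [hm.ne']
  have hedge : ∀ i,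
      (((m : ℤ), (0 : ℤ)) = (V i).1 ∨ ((m : ℤ), (0 : ℤ)) = (V i).2.1 ∨
        ((m : ℤ), (0 : ℤ)) = (V i).2.2) →
      (((0 : ℤ), (n : ℤ)) = (V i).1 ∨ ((0 : ℤ), (n : ℤ)) = (V i).2.1 ∨
        ((0 : ℤ), (n : ℤ)) = (V i).2.2) → i = 0 := by
    intro i hr hl
    obtain ⟨w', hw'⟩ := (hV i).exists_third hne hr hl
    exact hinj ((edge_facet_unique hn hm hT hw').trans hL0.symm)
  have hvA : ∀ i v, (v = (V i).1 ∨ v = (V i).2.1 ∨ v = (V i).2.2) → v ∈ newtonPoints n m := by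
    rintro i v (rfl | rfl | rfl)
    exacts [(hV i).mem₁, (hV i).mem₂, (hV i).mem₃]
  refine ⟨ω, N, V, hconv.subset (Set.subset_univ _) (convex_latticeTriangle _), ?_, ?_,
    fun p hp => hωΓ _ hp, ?_, fun i => affineIndependent_of_orient_ne_zero (hV i).nondeg, hcover,
    hdisj, fun i => ⟨(L i).1, (L i).2.1, (L i).2.2, hω i⟩, ?_, hvertex, by rw [hV0], by rw [hV0],
    by rw [hV0]; exact hΓ', ?_, ?_, ?_⟩
  · intro p hp
    obtain ⟨i, hi⟩ := Set.mem_iUnion.1 (hcover ▸ hp)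
    obtain ⟨a, b, c, ha, hb, hc, habc, e1, e2⟩ := mem_convexHull_triple.1 hi
    have hH0 : ∀ q ∈ newtonPoints n m, 0 ≤ H q := fun q hq =>
      Int.cast_nonneg (newtonHeight_nonneg hn hm hq)
    rw [hω i p hi, affEval_comb (L i) habc e1 e2, (hV i).eq₁, (hV i).eq₂, (hV i).eq₃]
    have h1 := mul_nonneg ha (hH0 _ (hV i).mem₁)
    have h2 := mul_nonneg hb (hH0 _ (hV i).mem₂)
    have h3 := mul_nonneg hc (hH0 _ (hV i).mem₃)
    linarith
  · intro p hp
    by_cases hpΓ : latticeEmb p ∈ Γ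
    · exact ⟨0, by rw [hωΓ _ hpΓ]; simp⟩
    · obtain ⟨i, hi⟩ := hvertex p hp hpΓ
      exact ⟨newtonHeight n m p, hωvertex i p hi⟩
  · intro i
    exact ⟨hVΔ i (latticeEmb_mem_of_eq (by simp)), hVΔ i (latticeEmb_mem_of_eq (by simp)),
      hVΔ i (latticeEmb_mem_of_eq (by simp))⟩
  · intro B
    constructor
    · rintro ⟨-, hBconv, hBΔ, hBaff, hBmax⟩
      obtain ⟨i, hi⟩ := hmax B hBconv hBΔ hBaff
      exact ⟨i, (hBmax _ (isClosed_latticeTriangle _) (convex_latticeTriangle _) (hVΔ i)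
        ⟨(L i).1, (L i).2.1, (L i).2.2, hω i⟩ hi).symm⟩
    · rintro ⟨i, rfl⟩
      exact ⟨isClosed_latticeTriangle _, convex_latticeTriangle _, hVΔ i,
        ⟨(L i).1, (L i).2.1, (L i).2.2, hω i⟩, fun C _ _ hC hCaff hsub => hmax' i C hC hCaff hsub⟩
  · rintro i hi ⟨u, v, hu, hv, huv⟩
    have endpoint : ∀ x, (x = (V i).1 ∨ x = (V i).2.1 ∨ x = (V i).2.2) →
        latticeEmb x ∈ segment ℝ (latticeEmb u) (latticeEmb v) →
        x = ((m : ℤ), 0) ∨ x = (0, (n : ℤ)) := fun x hx hxs =>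
      eq_endpoint_of_edgeGap_eq_zero hn hm (hvA i x hx) ((hmemΓ _).1 (huv ▸ hxs)).2.2
    have hu' := endpoint u hu (left_mem_segment _ _ _)
    have hv' := endpoint v hv (right_mem_segment _ _ _)
    have hdeg : u ≠ v := by
      rintro rfl
      rw [segment_same] at huv
      have h1 : latticeEmb ((m : ℤ), 0) ∈ ({latticeEmb u} : Set (ℝ × ℝ)) := by
        rw [huv, ← hΓ']; exact left_mem_segment _ _ _
      have h2 : latticeEmb (0, (n : ℤ)) ∈ ({latticeEmb u} : Set (ℝ × ℝ)) := by
        rw [huv, ← hΓ']; exact right_mem_segment _ _ _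
      exact hne (latticeEmb_injective (h1.trans h2.symm))
    rcases hu' with rfl | rfl <;> rcases hv' with rfl | rfl
    · exact hdeg rfl
    · exact hi (hedge i hu hv)
    · exact hi (hedge i hv hu)
    · exact hdeg rfl
  · have hdet : latticeDet ((m : ℤ), 0) (m - m', n') w = 1 ∨
        latticeDet ((m : ℤ), 0) (m - m', n') w = -1 := by
      clear_value H
      clear he
      subst hnn hmm
      convert edge_facet_det he0 hn' hm' hcop hg hT using 4 <;> push_cast <;> rfl
    refine ⟨!![-(m' : ℤ), w.1 - m; (n' : ℤ), w.2], ((m : ℤ), 0), ?_, ?_⟩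
    · rw [Matrix.det_fin_two_of]
      convert hdet using 2 <;> simp only [latticeDet] <;> ring
    · have hnR : (n : ℝ) = n' * e := by exact_mod_cast hnn
      have hmR : (m : ℝ) = m' * e := by exact_mod_cast hmm
      rw [hV0]
      ext p
      simp only [Set.mem_image, latticeTriangle, mem_convexHull_triple, latticeEmb]
      constructor
      · rintro ⟨a, b, c, ha, hb, hc, habc, e1, e2⟩
        refine ⟨(b * e, c), ⟨a, b, c, ha, hb, hc, habc, by simp, by simp⟩, ?_⟩
        ext
        · rw [← e1]
          simp
          linear_combination b * hmR - m * habc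
        · rw [← e2]
          simp
          linear_combination -b * hnR
      · rintro ⟨q, ⟨a, b, c, ha, hb, hc, habc, e1, e2⟩, rfl⟩
        refine ⟨a, b, c, ha, hb, hc, habc, ?_, ?_⟩
        · rw [← e1, ← e2]
          simp
          linear_combination -b * hmR + m * habc
        · rw [← e1, ← e2]
          simp
          linear_combination b * hnR
  · intro i hi
    change latticeDet (V i).1 (V i).2.1 (V i).2.2 = 1 ∨ latticeDet (V i).1 (V i).2.1 (V i).2.2 = -1
    refine latticeDet_eq_of_empty (fun h0 => (hV i).nondeg ?_) fun q hq => ?_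
    · rw [orient_latticeEmb, h0]; simp
    · by_cases hgap : affEval (edgeGap n m) (latticeEmb q) = 0
      · by_cases hqr : q = ((m : ℤ), 0)
        · exact (hV i).eq_vertex_of_mem hg
            ((mem_newtonPoints hn hm).2 (Or.inr (Or.inl hqr))) hq
        by_cases hql : q = (0, (n : ℤ))
        · exact (hV i).eq_vertex_of_mem hg
            ((mem_newtonPoints hn hm).2 (Or.inr (Or.inr hql))) hq
        obtain ⟨hr, hl⟩ := endpoints_of_mem_edge hn hm (hV i) hq hgap
          (fun h => hqr (latticeEmb_injective h)) (fun h => hql (latticeEmb_injective h))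
        exact absurd (hedge i hr hl) hi
      · exact (hV i).eq_vertex_of_mem hg
          (mem_newtonPoints_of_edgeGap_ne_zero hn hm (hVΔ i hq) hgap) hq
end
end
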